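/- arXiv:1706.09949 — 7 statements merged into one kernel-verified Lean document; each statement's English description precedes it below -/
import Mathlib

section
/- For all integers w ≥ 2, d ≥ 1 and any number n ≤ (w+1)d of objects, a stack rearrangement instance (π_I, π_G) admits a solution by permissible pop-and-push actions if and only if the corresponding pebble motion instance on the tree T admits a solution by pebble moves from the configuration x_{π_I} to the configuration x_{π_G}. -/
/-- An arrangement of `n` objects into `k` stacks of capacity `d`.
Depths are 0-based: Fin index `j` corresponds to depth `j+1`; index `0` is the top,
index `d-1` is the bottom (depth `d`). The occupied depths of every stack form a
contiguous block containing the bottom. -/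
structure Arrangement (n k d : ℕ) where
  pos : Fin n → Fin k × Fin d
  inj : Function.Injective pos
  contig : ∀ o : Fin n, ∀ j : Fin d, (pos o).2 ≤ j → ∃ o', pos o' = ((pos o).1, j)

/-- A permissible pop-and-push action: the top (minimal-depth) object `o` of a nonempty
stack is removed and pushed onto a different stack; all other objects stay put.
(Validity of the resulting `Arrangement` forces `o` to land on top of a stack that had
fewer than `d` objects.) -/
def Step {n k d : ℕ} (π π' : Arrangement n k d) : Prop :=
  ∃ o : Fin n,
    (π'.pos o).1 ≠ (π.pos o).1 ∧
    (∀ o' : Fin n, o' ≠ o → (π.pos o').1 = (π.pos o).1 → (π.pos o).2 < (π.pos o').2) ∧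
    (∀ o' : Fin n, o' ≠ o → π'.pos o' = π.pos o')

/-- `Reach π π' m`: the arrangement `π'` can be obtained from `π` by a sequence of
exactly `m` permissible pop-and-push actions. -/
def Reach {n k d : ℕ} (π π' : Arrangement n k d) (m : ℕ) : Prop :=
  ∃ f : ℕ → Arrangement n k d, f 0 = π ∧ f m = π' ∧ ∀ t, t < m → Step (f t) (f (t + 1))

/-- Vertices of the pebble-motion tree `T`: `none` is the root `r`, and
`some (i, j)` is the vertex `v_{i,j+1}` (stack `i`, 0-based depth `j`). -/
abbrev PVertex (w d : ℕ) := Option (Fin (w + 1) × Fin d)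

/-- Adjacency in the tree `T`: the root is joined to the top vertex `v_{i,1}` of every
stack path, and consecutive vertices along each stack path are joined. -/
def PAdj {w d : ℕ} (u v : PVertex w d) : Prop :=
  (u = none ∧ ∃ i : Fin (w + 1), ∃ j : Fin d, (j : ℕ) = 0 ∧ v = some (i, j)) ∨
  (v = none ∧ ∃ i : Fin (w + 1), ∃ j : Fin d, (j : ℕ) = 0 ∧ u = some (i, j)) ∨
  (∃ i : Fin (w + 1), ∃ j j' : Fin d, u = some (i, j) ∧ v = some (i, j') ∧
    ((j : ℕ) + 1 = (j' : ℕ) ∨ (j' : ℕ) + 1 = (j : ℕ)))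

/-- A pebble configuration: an injective placement of the objects (pebbles) on the
vertices of the tree `T`. -/
structure PConfig (n w d : ℕ) where
  pos : Fin n → PVertex w d
  inj : Function.Injective pos

/-- A pebble move: a single pebble moves to an adjacent vertex; injectivity of the
resulting configuration means the target vertex was unoccupied. -/
def PStep {n w d : ℕ} (x x' : PConfig n w d) : Prop :=
  ∃ o : Fin n, PAdj (x.pos o) (x'.pos o) ∧ ∀ o' : Fin n, o' ≠ o → x'.pos o' = x.pos o'

/-- The pebble configuration `x_π` associated to an arrangement `π`. -/
def toConfig {n w d : ℕ} (π : Arrangement n (w + 1) d) : PConfig n w d :=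
  ⟨fun o => some (π.pos o), fun a b h => π.inj (Option.some.inj h)⟩

namespace PConfig

variable {n w d : ℕ}

/-- Relocate the object `o` to the unoccupied vertex `v`. -/
def move (x : PConfig n w d) (o : Fin n) (v : PVertex w d)
    (hv : ∀ o', o' ≠ o → x.pos o' ≠ v) : PConfig n w d where
  pos := Function.update x.pos o v
  inj := by
    intro a b hab
    by_cases ha : a = o <;> by_cases hb : b = o
    · rw [ha, hb]
    · subst ha
      rw [Function.update_self, Function.update_of_ne hb] at hab
      exact absurd hab.symm (hv b hb)
    · subst hb
      rw [Function.update_self, Function.update_of_ne ha] at hab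
      exact absurd hab (hv a ha)
    · rw [Function.update_of_ne ha, Function.update_of_ne hb] at hab
      exact x.inj hab

end PConfig

theorem PAdj.symm {w d : ℕ} {u v : PVertex w d} (h : PAdj u v) : PAdj v u := by
  rcases h with h | h | ⟨i, j, j', hu, hv, h⟩
  · exact Or.inr (Or.inl h)
  · exact Or.inl h
  · exact Or.inr (Or.inr ⟨i, j', j, hv, hu, h.symm⟩)

theorem PStep.symm {n w d : ℕ} {x y : PConfig n w d} (h : PStep x y) : PStep y x := by
  obtain ⟨o, hadj, hrest⟩ := h
  exact ⟨o, hadj.symm, fun o' ho' => (hrest o' ho').symm⟩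

instance {n w d : ℕ} : Std.Symm (PStep (n := n) (w := w) (d := d)) :=
  ⟨fun _ _ => PStep.symm⟩

/-- The topmost object of a stack can be brought to the root, if the root is free. -/
theorem PConfig.reach_root {n w d : ℕ} (o : Fin n) (i : Fin (w + 1)) (y : PConfig n w d)
    (hy : y.pos o = none) (m : ℕ) : ∀ (x : PConfig n w d) (j : Fin d), (j : ℕ) = m →
    x.pos o = some (i, j) → (∀ o' k, x.pos o' = some (i, k) → j ≤ k) →
    (∀ o', o' ≠ o → y.pos o' = x.pos o') → Relation.ReflTransGen PStep x y := by
  induction m with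
  | zero =>
    intro x j hj hx _ hxy
    exact .single ⟨o, Or.inr (Or.inl ⟨hy, i, j, hj, hx⟩), hxy⟩
  | succ m ih =>
    intro x j hj hx htop hxy
    have hm : m < d := by omega
    have hfree : ∀ o', o' ≠ o → x.pos o' ≠ some (i, ⟨m, hm⟩) := by
      intro o' _ h
      have := Fin.le_def.1 (htop o' _ h)
      simp only at this
      omega
    have hself : (x.move o _ hfree).pos o = some (i, ⟨m, hm⟩) := Function.update_self ..
    have hne : ∀ o', o' ≠ o → (x.move o _ hfree).pos o' = x.pos o' :=
      fun o' ho' => Function.update_of_ne ho' ..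
    refine .head (b := x.move o _ hfree) ⟨o, ?_, hne⟩ (ih _ ⟨m, hm⟩ rfl hself ?_ ?_)
    · exact Or.inr (Or.inr ⟨i, j, ⟨m, hm⟩, hx, hself, Or.inr hj.symm⟩)
    · intro o' k hk
      by_cases ho' : o' = o
      · subst ho'
        rw [hself] at hk
        simp only [Option.some.injEq, Prod.mk.injEq, true_and] at hk
        exact hk.le
      · rw [hne o' ho'] at hk
        have := Fin.le_def.1 (htop o' k hk)
        rw [Fin.le_def]
        simp only
        omega
    · intro o' ho'
      rw [hne o' ho', hxy o' ho']

theorem Step.reflTransGen_pStep {n w d : ℕ} {π π' : Arrangement n (w + 1) d}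
    (h : Step π π') : Relation.ReflTransGen PStep (toConfig π) (toConfig π') := by
  obtain ⟨o, hstack, htop, hrest⟩ := h
  have hfree : ∀ o', o' ≠ o → (toConfig π).pos o' ≠ none := fun o' _ h => nomatch h
  let y := (toConfig π).move o none hfree
  have hself : y.pos o = none := Function.update_self ..
  have hne : ∀ o', o' ≠ o → y.pos o' = some (π.pos o') :=
    fun o' ho' => Function.update_of_ne ho' ..
  have hup : Relation.ReflTransGen PStep (toConfig π) y := by
    refine PConfig.reach_root o (π.pos o).1 y hself _ _ (π.pos o).2 rfl rfl ?_ hne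
    intro o' k hk
    have hk : π.pos o' = ((π.pos o).1, k) := Option.some.inj hk
    by_cases ho' : o' = o
    · subst ho'
      exact (congrArg Prod.snd hk).le
    · have := htop o' ho' (by rw [hk])
      rw [hk] at this
      exact this.le
  have hup' : Relation.ReflTransGen PStep (toConfig π') y := by
    refine PConfig.reach_root o (π'.pos o).1 y hself _ _ (π'.pos o).2 rfl rfl ?_ ?_
    · intro o' k hk
      have hk : π'.pos o' = ((π'.pos o).1, k) := Option.some.inj hk
      by_contra! hlt
      have ho' : o' ≠ o := by
        rintro rfl
        rw [hk] at hlt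
        exact lt_irrefl _ hlt
      have hπ : π.pos o' = ((π'.pos o).1, k) := by rw [← hrest o' ho', hk]
      obtain ⟨a, ha⟩ := π.contig o' (π'.pos o).2 (by rw [hπ]; exact hlt.le)
      rw [hπ] at ha
      have hao : a ≠ o := by
        rintro rfl
        exact hstack (by rw [ha])
      exact hao (π'.inj (by rw [hrest a hao, ha]))
    · intro o' ho'
      rw [hne o' ho', ← hrest o' ho']
      rfl
  exact hup.trans (Relation.ReflTransGen.stdSymm.symm _ _ hup')

/-- An arrangement `π` represents a pebble configuration `x` if every object off the root lies
in the same stack in both, with the same order inside each stack, and the object on the root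
(if any) is on top of some stack of `π`. -/
structure Represents {n w d : ℕ} (x : PConfig n w d) (π : Arrangement n (w + 1) d) : Prop where
  stack : ∀ o i j, x.pos o = some (i, j) → (π.pos o).1 = i
  order : ∀ o o' i j j', x.pos o = some (i, j) → x.pos o' = some (i, j') → j < j' →
    (π.pos o).2 < (π.pos o').2
  root : ∀ o, x.pos o = none → ∀ o', o' ≠ o → (π.pos o').1 = (π.pos o).1 →
    (π.pos o).2 < (π.pos o').2

theorem represents_toConfig {n w d : ℕ} (π : Arrangement n (w + 1) d) :
    Represents (toConfig π) π where
  stack o i j h := by rw [Option.some.inj h]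
  order o o' i j j' h h' hlt := by rw [Option.some.inj h, Option.some.inj h']; exact hlt
  root o h := nomatch h

theorem Arrangement.ext_pos {n k d : ℕ} {π π' : Arrangement n k d}
    (h : ∀ o, π.pos o = π'.pos o) : π = π' := by
  obtain ⟨p, hp, hc⟩ := π
  obtain ⟨q, hq, hc'⟩ := π'
  have : p = q := funext h
  subst this
  rfl

theorem Arrangement.depth_le {n k d : ℕ} {π π' : Arrangement n k d}
    (ho : ∀ o o', (π'.pos o).1 = (π'.pos o').1 → (π'.pos o).2 < (π'.pos o').2 →
      (π.pos o).2 < (π.pos o').2) (m : ℕ) :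
    ∀ o, (π'.pos o).2 + m = d → (π.pos o).2 ≤ (π'.pos o).2 := by
  induction m with
  | zero => intro o h; omega
  | succ m ih =>
    intro o h
    rcases Nat.eq_zero_or_pos m with rfl | hm
    · rw [Fin.le_def]; omega
    · obtain ⟨a, ha⟩ := π'.contig o ⟨(π'.pos o).2 + 1, by omega⟩ (by simp [Fin.le_def])
      have hlt := ho o a (by rw [ha]) (by rw [ha]; simp [Fin.lt_def])
      have hle := ih a (by rw [ha]; simp only; omega)
      rw [ha] at hle
      rw [Fin.le_def] at hle ⊢
      rw [Fin.lt_def] at hlt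
      simp only at hle
      omega

theorem Arrangement.eq_of_order {n k d : ℕ} {π π' : Arrangement n k d}
    (hs : ∀ o, (π.pos o).1 = (π'.pos o).1)
    (ho : ∀ o o', (π'.pos o).1 = (π'.pos o').1 → (π'.pos o).2 < (π'.pos o').2 →
      (π.pos o).2 < (π.pos o').2) : π = π' := by
  have ho' : ∀ o o', (π.pos o).1 = (π.pos o').1 → (π.pos o).2 < (π.pos o').2 →
      (π'.pos o).2 < (π'.pos o').2 := by
    intro o o' h hlt
    have h' : (π'.pos o).1 = (π'.pos o').1 := by rw [← hs, ← hs, h]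
    rcases lt_trichotomy (π'.pos o).2 (π'.pos o').2 with hc | hc | hc
    · exact hc
    · have := π'.inj (Prod.ext h' hc)
      subst this
      exact absurd hlt (lt_irrefl _)
    · exact absurd (ho o' o h'.symm hc) hlt.asymm
  refine Arrangement.ext_pos fun o => Prod.ext (hs o) (le_antisymm ?_ ?_)
  · exact depth_le ho (d - (π'.pos o).2) o (by omega)
  · exact depth_le ho' (d - (π.pos o).2) o (by omega)

theorem Represents.eq_of_toConfig {n w d : ℕ} {π π' : Arrangement n (w + 1) d}
    (h : Represents (toConfig π') π) : π = π' :=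
  Arrangement.eq_of_order (fun o => h.stack o _ _ rfl) fun o o' hs hlt =>
    h.order o o' (π'.pos o).1 _ _ rfl (by rw [hs]; rfl) hlt

/-- The top object of a stack can be moved onto any other stack whose top slot is free. -/
theorem Arrangement.exists_push {n k d : ℕ} (π : Arrangement n k d) (o : Fin n)
    (htop : ∀ o', o' ≠ o → (π.pos o').1 = (π.pos o).1 → (π.pos o).2 < (π.pos o').2)
    (i : Fin k) (hi : i ≠ (π.pos o).1) (j₀ : Fin d) (hfree : ∀ o', π.pos o' ≠ (i, j₀)) :
    ∃ π' : Arrangement n k d, Step π π' ∧ (π'.pos o).1 = i ∧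
      (∀ o', o' ≠ o → π'.pos o' = π.pos o') ∧
      ∀ o', o' ≠ o → (π'.pos o').1 = i → (π'.pos o).2 < (π'.pos o').2 := by
  classical
  let S : Finset (Fin d) := Finset.univ.filter fun j => ∀ o', π.pos o' ≠ (i, j)
  have hS : S.Nonempty := ⟨j₀, by simpa [S] using hfree⟩
  obtain ⟨j, hjS, hmax⟩ := S.exists_max_image id hS
  have hj : ∀ o', π.pos o' ≠ (i, j) := by simpa [S] using hjS
  have hbelow : ∀ l, j < l → ∃ o', π.pos o' = (i, l) := by
    intro l hl
    by_contra! hc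
    exact absurd (hmax l (by simpa [S] using hc)) (not_le.2 hl)
  have habove : ∀ o', (π.pos o').1 = i → j < (π.pos o').2 := by
    intro o' ho'
    by_contra! hc
    obtain ⟨a, ha⟩ := π.contig o' j hc
    exact hj a (by rw [ha, ho'])
  have hself : Function.update π.pos o (i, j) o = (i, j) := Function.update_self ..
  have hne : ∀ o', o' ≠ o → Function.update π.pos o (i, j) o' = π.pos o' :=
    fun o' ho' => Function.update_of_ne ho' ..
  let π' : Arrangement n k d :=
    { pos := Function.update π.pos o (i, j)
      inj := by
        intro a b hab
        by_cases ha : a = o <;> by_cases hb : b = o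
        · rw [ha, hb]
        · subst ha
          rw [hself, hne b hb] at hab
          exact absurd hab.symm (hj b)
        · subst hb
          rw [hself, hne a ha] at hab
          exact absurd hab (hj a)
        · rw [hne a ha, hne b hb] at hab
          exact π.inj hab
      contig := by
        intro a l hl
        by_cases ha : a = o
        · subst ha
          rw [hself] at hl ⊢
          rcases hl.eq_or_lt with h | h
          · exact ⟨a, by rw [hself, ← h]⟩
          · obtain ⟨b, hb⟩ := hbelow l h
            have hba : b ≠ a := by
              rintro rfl
              exact hi (by rw [hb])
            exact ⟨b, by rw [hne b hba, hb]⟩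
        · rw [hne a ha] at hl ⊢
          obtain ⟨b, hb⟩ := π.contig a l hl
          have hbo : b ≠ o := by
            rintro rfl
            have := htop a ha (by rw [hb])
            rw [hb] at this
            exact absurd hl (not_le.2 this)
          exact ⟨b, by rw [hne b hbo, hb]⟩ }
  refine ⟨π', ⟨o, ?_, htop, hne⟩, congrArg Prod.fst hself, hne, ?_⟩
  · change (Function.update π.pos o (i, j) o).1 ≠ _
    rw [hself]
    exact hi
  · intro o' ho' hs
    change (Function.update π.pos o (i, j) o).2 < (Function.update π.pos o (i, j) o').2
    change (Function.update π.pos o (i, j) o').1 = i at hs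
    rw [hne o' ho'] at hs ⊢
    rw [hself]
    exact habove o' hs

/-- If the top vertex of stack `i` is unoccupied in `x` and the root object of `x`, if any, is not
in stack `i` of the representing arrangement, then the top slot of stack `i` is free there too. -/
theorem Represents.top_free {n w d : ℕ} {x : PConfig n w d} {π : Arrangement n (w + 1) d}
    (h : Represents x π) {i : Fin (w + 1)} {j₀ : Fin d} (hj₀ : (j₀ : ℕ) = 0)
    (hx : ∀ o, x.pos o ≠ some (i, j₀)) (hr : ∀ o, x.pos o = none → (π.pos o).1 ≠ i) :
    ∀ o, π.pos o ≠ (i, j₀) := by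
  intro o ho
  have hfull : ∀ j : Fin d, ∃ a, ∃ l : Fin d, π.pos a = (i, j) ∧ x.pos a = some (i, l) := by
    intro j
    obtain ⟨a, ha⟩ := π.contig o j (by rw [ho, Fin.le_def]; simp only; omega)
    rw [ho] at ha
    rcases hxa : x.pos a with _ | ⟨i', l⟩
    · exact absurd (by rw [ha]) (hr a hxa)
    · have := h.stack a i' l hxa
      rw [ha] at this
      exact ⟨a, l, ha, by rw [hxa, ← this]⟩
  choose a l ha hl using hfull
  have hinj : Function.Injective l := by
    intro j j' hjj
    have := x.inj ((hl j).trans (by rw [hjj, hl j']))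
    have h2 := ha j
    rw [this, ha j'] at h2
    exact (congrArg Prod.snd h2).symm
  obtain ⟨j, hj⟩ := Finite.surjective_of_injective hinj j₀
  exact hx (a j) (by rw [hl, hj])

theorem Represents.exists_of_pStep {n w d : ℕ} {x x' : PConfig n w d}
    {π : Arrangement n (w + 1) d} (h : Represents x π) (hstep : PStep x x') :
    ∃ π', Represents x' π' ∧ Relation.ReflTransGen Step π π' := by
  obtain ⟨o, hadj, hrest⟩ := hstep
  rcases hadj with ⟨hx, i, j, hj, hx'⟩ | ⟨hx', i, j, hj, hx⟩ | ⟨i, j, j', hx, hx', hjj⟩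
  · have hother : ∀ o' i' l, o' ≠ o → x'.pos o' = some (i', l) → x.pos o' = some (i', l) :=
      fun o' i' l ho' hl => by rw [← hrest o' ho', hl]
    have hrootne : ∀ o', x'.pos o' ≠ none := by
      intro o' ho'
      have hne : o' ≠ o := by
        rintro rfl
        rw [hx'] at ho'
        cases ho'
      rw [hrest o' hne, ← hx] at ho'
      exact hne (x.inj ho')
    suffices ∃ π' : Arrangement n (w + 1) d, Relation.ReflTransGen Step π π' ∧
        (π'.pos o).1 = i ∧ (∀ o', o' ≠ o → π'.pos o' = π.pos o') ∧
        ∀ o', o' ≠ o → (π'.pos o').1 = i → (π'.pos o).2 < (π'.pos o').2 by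
      obtain ⟨π', hreach, hs, hsame, htop⟩ := this
      have hstack : ∀ o' i' l, x'.pos o' = some (i', l) → (π'.pos o').1 = i' := by
        intro o' i' l hl
        by_cases ho' : o' = o
        · subst ho'
          rw [hx'] at hl
          rw [hs]
          exact congrArg Prod.fst (Option.some.inj hl)
        · rw [hsame o' ho']
          exact h.stack o' i' l (hother o' i' l ho' hl)
      refine ⟨π', ⟨hstack, ?_, fun o' ho' => absurd ho' (hrootne o')⟩, hreach⟩
      intro a b i' l l' hl hl' hlt
      by_cases hb : b = o
      · subst hb
        rw [hx'] at hl'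
        have := congrArg Prod.snd (Option.some.inj hl')
        simp only at this
        rw [Fin.lt_def, ← this] at hlt
        omega
      · by_cases ha : a = o
        · subst ha
          rw [hx'] at hl
          have := congrArg Prod.fst (Option.some.inj hl)
          simp only at this
          exact htop b hb (by rw [hstack b i' l' hl', this])
        · rw [hsame a ha, hsame b hb]
          exact h.order a b i' l l' (hother a i' l ha hl) (hother b i' l' hb hl') hlt
    have htop := h.root o hx
    by_cases hi : i = (π.pos o).1
    · exact ⟨π, .refl, hi.symm, fun _ _ => rfl, fun o' ho' hs => htop o' ho' (hs.trans hi)⟩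
    · have hfree : ∀ o', π.pos o' ≠ (i, j) := by
        refine h.top_free hj ?_ ?_
        · intro o' ho'
          have hne : o' ≠ o := by
            rintro rfl
            rw [hx] at ho'
            cases ho'
          rw [← hrest o' hne, ← hx'] at ho'
          exact hne (x'.inj ho')
        · intro o' ho'
          rw [← hx] at ho'
          rw [x.inj ho']
          exact fun hc => hi hc.symm
      obtain ⟨π', hst, hrem⟩ := π.exists_push o htop i hi j hfree
      exact ⟨π', .single hst, hrem⟩
  · have hne : ∀ o' i' l, x'.pos o' = some (i', l) → o' ≠ o ∧ x.pos o' = some (i', l) := by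
      intro o' i' l hl
      have hne : o' ≠ o := by
        rintro rfl
        rw [hx'] at hl
        cases hl
      exact ⟨hne, by rw [← hrest o' hne, hl]⟩
    refine ⟨π, ⟨fun o' i' l hl => h.stack o' i' l (hne o' i' l hl).2,
      fun a b i' l l' hl hl' => h.order a b i' l l' (hne a i' l hl).2 (hne b i' l' hl').2, ?_⟩,
      .refl⟩
    intro a ha b hb hs
    have hao : a = o := x'.inj (by rw [ha, hx'])
    subst hao
    rcases hxb : x.pos b with _ | ⟨i', l⟩
    · have : x'.pos b = none := by rw [hrest b hb, hxb]
      exact absurd (x'.inj (this.trans hx'.symm)) hb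
    · have hii : i' = i := by
        rw [← h.stack b i' l hxb, ← h.stack a i j hx, hs]
      subst hii
      refine h.order a b i' j l hx hxb ?_
      rw [Fin.lt_def]
      have : (j : ℕ) ≠ l := by
        intro hc
        rw [← Fin.ext hc, ← hx] at hxb
        exact hb (x.inj hxb)
      omega
  · have hne : ∀ o' l, o' ≠ o → x.pos o' = some (i, l) → (l : ℕ) ≠ j ∧ (l : ℕ) ≠ j' := by
      intro o' l ho' hl
      refine ⟨fun hc => ?_, fun hc => ?_⟩
      · rw [Fin.ext hc, ← hx] at hl
        exact ho' (x.inj hl)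
      · rw [Fin.ext hc, ← hx', ← hrest o' ho'] at hl
        exact ho' (x'.inj hl)
    have hother : ∀ o' i' l, o' ≠ o → x'.pos o' = some (i', l) → x.pos o' = some (i', l) :=
      fun o' i' l ho' hl => by rw [← hrest o' ho', hl]
    refine ⟨π, ⟨?_, ?_, ?_⟩, .refl⟩
    · intro a i' l hl
      by_cases ha : a = o
      · subst ha
        rw [hx'] at hl
        rw [h.stack a i j hx]
        exact congrArg Prod.fst (Option.some.inj hl)
      · exact h.stack a i' l (hother a i' l ha hl)
    · intro a b i' l l' hl hl' hlt
      rw [Fin.lt_def] at hlt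
      by_cases ha : a = o <;> by_cases hb : b = o
      · subst ha hb
        rw [hl] at hl'
        have := congrArg Prod.snd (Option.some.inj hl')
        simp only at this
        rw [this] at hlt
        exact absurd hlt (lt_irrefl _)
      · subst ha
        rw [hx'] at hl
        obtain ⟨rfl, rfl⟩ := Prod.mk.inj (Option.some.inj hl)
        have hl' := hother b i l' hb hl'
        have := hne b l' hb hl'
        exact h.order a b i j l' hx hl' (by rw [Fin.lt_def]; omega)
      · subst hb
        rw [hx'] at hl'
        obtain ⟨rfl, rfl⟩ := Prod.mk.inj (Option.some.inj hl')
        have hl := hother a i l ha hl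
        have := hne a l ha hl
        exact h.order a b i l j hl hx (by rw [Fin.lt_def]; omega)
      · exact h.order a b i' l l' (hother a i' l ha hl) (hother b i' l' hb hl')
          (Fin.lt_def.2 hlt)
    · intro a ha
      have hao : a ≠ o := by
        rintro rfl
        rw [hx'] at ha
        cases ha
      exact h.root a (by rw [← hrest a hao, ha])

theorem Represents.exists_of_reflTransGen {n w d : ℕ} {x x' : PConfig n w d}
    {π : Arrangement n (w + 1) d} (h : Represents x π)
    (hreach : Relation.ReflTransGen PStep x x') :
    ∃ π', Represents x' π' ∧ Relation.ReflTransGen Step π π' := by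
  induction hreach with
  | refl => exact ⟨π, h, .refl⟩
  | tail _ hstep ih =>
    obtain ⟨π₁, h₁, hπ₁⟩ := ih
    obtain ⟨π₂, h₂, hπ₂⟩ := h₁.exists_of_pStep hstep
    exact ⟨π₂, h₂, hπ₁.trans hπ₂⟩

/-- For all integers `w ≥ 2`, `d ≥ 1` and any number `n ≤ (w+1)*d` of objects,
a stack rearrangement instance `(π_I, π_G)` admits a solution by permissible pop-and-push
actions if and only if the corresponding pebble motion instance on the tree `T` admits a
solution by pebble moves from `x_{π_I}` to `x_{π_G}`. -/
theorem lsr_solvable_iff_pmt_solvable (w d n : ℕ) (hw : 2 ≤ w) (hd : 1 ≤ d)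
    (hn : n ≤ (w + 1) * d) (πI πG : Arrangement n (w + 1) d) :
    Relation.ReflTransGen Step πI πG ↔
      Relation.ReflTransGen PStep (toConfig πI) (toConfig πG) := by
  constructor
  · intro h
    induction h with
    | refl => exact .refl
    | tail _ hstep ih => exact ih.trans hstep.reflTransGen_pStep
  · intro h
    obtain ⟨π, hπ, hreach⟩ := (represents_toConfig πI).exists_of_reflTransGen h
    exact hπ.eq_of_toConfig ▸ hreach
end

section
/- For all integers w ≥ 2, d ≥ 1 and all n ≤ wd, every LSR instance (π_I, π_G) with n objects has a solution, i.e., the goal arrangement π_G is reachable from π_I by a finite sequence of permissible pop-and-push actions. -/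
namespace StackRearrangement

open Function
open Relation (ReflTransGen)

/-- Stacks as lists, top first: the head of one list is transferred onto another list
that holds fewer than `d` elements. -/
def Move {k : ℕ} {α : Type*} (d : ℕ) (S S' : Fin k → List α) : Prop :=
  ∃ i j x, i ≠ j ∧ S i = x :: S' i ∧ S' j = x :: S j ∧ (S j).length < d ∧
    ∀ l, l ≠ i → l ≠ j → S' l = S l

/-- The lists `L` describe the arrangement `π`. -/
def Represents {n k d : ℕ} (π : Arrangement n k d) (L : Fin k → List (Fin n)) : Prop :=
  ∀ i o t, (L i).reverse[t]? = some o ↔ (π.pos o).1 = i ∧ (π.pos o).2.val + t + 1 = d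

section Arrangements

variable {n k d : ℕ}

theorem step_symm {π π' : Arrangement n k d} (h : Step π π') : Step π' π := by
  obtain ⟨o, h1, h2, h3⟩ := h
  refine ⟨o, h1.symm, fun o' ho' hs => ?_, fun o' ho' => (h3 o' ho').symm⟩
  by_contra hlt
  rw [h3 o' ho'] at hs hlt
  obtain ⟨o'', ho''⟩ := π.contig o' (π'.pos o).2 (not_lt.mp hlt)
  rw [hs] at ho''
  by_cases hoo : o'' = o
  · subst hoo
    exact h1 (by rw [ho''])
  · rw [← h3 o'' hoo] at ho''
    exact hoo (π'.inj ho'')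

theorem reach_symm {π π' : Arrangement n k d} (h : ReflTransGen Step π π') :
    ReflTransGen Step π' π := by
  induction h with
  | refl => exact .refl
  | tail _ h ih => exact .head (step_symm h) ih

theorem exists_list_getElem? {α : Type*} (d : ℕ) (p : ℕ → Option α)
    (hp : ∀ t, (p (t + 1)).isSome → (p t).isSome) (hd : ∀ t, d ≤ t → p t = none) :
    ∃ l : List α, ∀ t : ℕ, l[t]? = p t := by
  induction d generalizing p with
  | zero => exact ⟨[], fun t => by simp [hd t]⟩
  | succ d ih =>
    obtain ⟨l, hl⟩ := ih (fun t => p (t + 1)) (fun t => hp (t + 1))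
      (fun t ht => hd _ (by omega))
    cases h0 : p 0 with
    | none =>
      refine ⟨[], fun t => ?_⟩
      have : p t = none := by
        induction t with
        | zero => exact h0
        | succ t iht =>
          have := hp t
          simp only [iht] at this
          simpa using this
      simp [this]
    | some a =>
      refine ⟨a :: l, fun t => ?_⟩
      cases t with
      | zero => simp [h0]
      | succ t => simp [hl]

theorem exists_represents (π : Arrangement n k d) : ∃ L, Represents π L := by
  classical
  have key : ∀ i : Fin k, ∃ l : List (Fin n), ∀ o t,
      l[t]? = some o ↔ (π.pos o).1 = i ∧ (π.pos o).2.val + t + 1 = d := by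
    intro i
    let Q : ℕ → Fin n → Prop := fun t o => (π.pos o).1 = i ∧ (π.pos o).2.val + t + 1 = d
    have huniq : ∀ t o o', Q t o → Q t o' → o = o' := by
      rintro t o o' ⟨h1, h2⟩ ⟨h3, h4⟩
      exact π.inj (Prod.ext (h1.trans h3.symm) (Fin.ext (by omega)))
    let p : ℕ → Option (Fin n) := fun t => if h : ∃ o, Q t o then some h.choose else none
    have hp : ∀ t o, p t = some o ↔ Q t o := by
      intro t o
      by_cases h : ∃ o, Q t o
      · simp only [p, dif_pos h, Option.some.injEq]
        exact ⟨fun e => e ▸ h.choose_spec, fun e => huniq _ _ _ h.choose_spec e⟩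
      · simp only [p, dif_neg h]
        simpa using fun e => h ⟨o, e⟩
    obtain ⟨l, hl⟩ := exists_list_getElem? d p
      (by
        intro t ht
        obtain ⟨o, ho⟩ := Option.isSome_iff_exists.mp ht
        obtain ⟨h1, h2⟩ := (hp _ _).mp ho
        obtain ⟨o', ho'⟩ := π.contig o ⟨(π.pos o).2.val + 1, by omega⟩
          (Fin.le_def.mpr (Nat.le_succ _))
        refine Option.isSome_iff_exists.mpr ⟨o', (hp _ _).mpr ⟨by rw [ho']; exact h1, ?_⟩⟩
        rw [ho']
        simp only
        omega)
      (by
        intro t ht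
        by_contra hne
        obtain ⟨o, ho⟩ := Option.ne_none_iff_exists'.mp hne
        obtain ⟨_, h2⟩ := (hp _ _).mp ho
        omega)
    exact ⟨l, fun o t => by rw [hl, hp]⟩
  choose L hL using key
  exact ⟨fun i => (L i).reverse, fun i o t => by simpa using hL i o t⟩

theorem Represents.eq {π π' : Arrangement n k d} {L : Fin k → List (Fin n)}
    (h : Represents π L) (h' : Represents π' L) : π = π' := by
  have : π.pos = π'.pos := by
    funext o
    have hlt := (π.pos o).2.isLt
    obtain ⟨h1, h2⟩ := (h' (π.pos o).1 o (d - 1 - (π.pos o).2.val)).mp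
      ((h _ _ _).mpr ⟨rfl, by omega⟩)
    exact Prod.ext h1.symm (Fin.ext (by omega))
  cases π
  cases π'
  simpa using this

theorem Represents.length_le {π : Arrangement n k d} {L : Fin k → List (Fin n)}
    (h : Represents π L) (i : Fin k) : (L i).length ≤ d := by
  by_contra hlt
  have hd : d < (L i).reverse.length := by simpa using hlt
  have := ((h i _ d).mp (List.getElem?_eq_getElem hd)).2
  omega

theorem exists_arrangement (f : Fin n → Fin k × Fin d) (L : Fin k → List (Fin n))
    (h : ∀ i o t, (L i).reverse[t]? = some o ↔ (f o).1 = i ∧ (f o).2.val + t + 1 = d) :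
    ∃ π : Arrangement n k d, π.pos = f ∧ Represents π L := by
  refine ⟨⟨f, fun o o' e => ?_, fun o j hj => ?_⟩, rfl, h⟩
  · have hlt := (f o).2.isLt
    have h1 := (h (f o).1 o (d - 1 - (f o).2.val)).mpr ⟨rfl, by omega⟩
    have h2 := (h (f o).1 o' (d - 1 - (f o).2.val)).mpr ⟨by rw [e], by rw [← e]; omega⟩
    exact Option.some.inj (h1.symm.trans h2)
  · have hlt := (f o).2.isLt
    have h1 := (h (f o).1 o (d - 1 - (f o).2.val)).mpr ⟨rfl, by omega⟩
    obtain ⟨hlen, -⟩ := List.getElem?_eq_some_iff.mp h1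
    have hj' := Fin.le_def.mp hj
    have hlen' : d - 1 - j.val < (L (f o).1).reverse.length := by omega
    obtain ⟨h2, h3⟩ := (h _ _ _).mp (List.getElem?_eq_getElem hlen')
    exact ⟨_, Prod.ext h2 (Fin.ext (by have := j.isLt; simp only; omega))⟩

theorem Represents.step {π : Arrangement n k d} {L L' : Fin k → List (Fin n)}
    (h : Represents π L) (hm : Move d L L') : ∃ π', Step π π' ∧ Represents π' L' := by
  obtain ⟨i, j, x, hij, hi, hj, hlen, hrest⟩ := hm
  have hx := (h i x (L' i).length).mp (by simp [hi])
  have hnot : ∀ t : ℕ, (L' i).reverse[t]? ≠ some x := by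
    intro t ht
    have hlt := (List.getElem?_eq_some_iff.mp ht).1
    have := (h i x t).mp (by rw [hi, List.reverse_cons, List.getElem?_append_left hlt]; exact ht)
    simp only [List.length_reverse] at hlt
    omega
  obtain ⟨π', hπ', hr⟩ := exists_arrangement
    (update π.pos x (j, ⟨d - 1 - (L j).length, by omega⟩)) L' (by
      intro l o t
      by_cases ho : o = x
      · subst ho
        simp only [update_self]
        by_cases hl : l = j
        · subst hl
          have hnl : (L l).reverse[t]? ≠ some o := by
            intro e
            exact hij (hx.1.symm.trans ((h _ _ _).mp e).1)
          rw [hj, List.reverse_cons, List.getElem?_append]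
          split_ifs with hlt
          · simp only [List.length_reverse] at hlt
            simp only [hnl, false_iff]
            omega
          · simp only [List.length_reverse] at hlt ⊢
            rw [List.getElem?_singleton]
            split_ifs with h0
            · simp; omega
            · simp; omega
        · have : (L' l).reverse[t]? ≠ some o := by
            by_cases hli : l = i
            · subst hli; exact hnot t
            · rw [hrest l hli hl]
              intro e
              exact hli (((h _ _ _).mp e).1.symm.trans hx.1)
          simp [this, Ne.symm hl]
      · rw [update_of_ne ho, ← h l o t]
        by_cases hli : l = i
        · subst hli
          rw [hi, List.reverse_cons, List.getElem?_append]
          split_ifs with hlt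
          · rfl
          · rw [List.getElem?_eq_none (l := (L' l).reverse) (by omega), List.getElem?_singleton]
            split_ifs <;> simp [Ne.symm ho]
        · by_cases hlj : l = j
          · subst hlj
            rw [hj, List.reverse_cons, List.getElem?_append]
            split_ifs with hlt
            · rfl
            · rw [List.getElem?_eq_none (l := (L l).reverse) (by omega), List.getElem?_singleton]
              split_ifs <;> simp [Ne.symm ho]
          · rw [hrest l hli hlj])
  refine ⟨π', ⟨x, ?_, fun o' ho' hs => ?_, fun o' ho' => ?_⟩, hr⟩
  · rw [hπ', update_self, hx.1]
    exact hij.symm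
  · have hlt := (π.pos o').2.isLt
    have h1 := (h i o' (d - 1 - (π.pos o').2.val)).mpr ⟨hs.trans hx.1, by omega⟩
    have h2 := (List.getElem?_eq_some_iff.mp h1).1
    simp only [hi, List.length_reverse, List.length_cons] at h2
    have h3 : (π.pos o').2 ≠ (π.pos x).2 := fun e => ho' (π.inj (Prod.ext hs e))
    have h4 : (π.pos o').2.val ≠ (π.pos x).2.val := fun e => h3 (Fin.ext e)
    rw [Fin.lt_def]
    omega
  · rw [hπ', update_of_ne ho']

/-- Moves of padded stacks are simulated by the arrangements obtained by dropping the
padding. -/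
theorem Represents.reach {π : Arrangement n k d} {S S' : Fin k → List (Option (Fin n))}
    (h : Represents π fun i => (S i).reduceOption) (hm : ReflTransGen (Move d) S S') :
    ∃ π', ReflTransGen Step π π' ∧ Represents π' fun i => (S' i).reduceOption := by
  induction hm with
  | refl => exact ⟨π, .refl, h⟩
  | @tail T T' _ hm ih =>
    obtain ⟨π₁, hπ₁, h₁⟩ := ih
    obtain ⟨i, j, x, hij, hi, hj, hlen, hrest⟩ := hm
    cases x with
    | none =>
      refine ⟨π₁, hπ₁, ?_⟩
      convert h₁ using 2 with l
      by_cases hli : l = i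
      · subst hli
        simp [hi]
      · by_cases hlj : l = j
        · subst hlj
          simp [hj]
        · rw [hrest l hli hlj]
    | some x =>
      obtain ⟨π₂, hs, h₂⟩ := h₁.step (L' := fun i => (T' i).reduceOption)
        ⟨i, j, x, hij, by simp [hi], by simp [hj],
          (List.reduceOption_length_le _).trans_lt hlen,
          fun l h1 h2 => by simp only [hrest l h1 h2]⟩
      exact ⟨π₂, hπ₁.tail hs, h₂⟩

theorem exists_reach_empty {w : ℕ} (hn : n ≤ w * d) (m : ℕ) (π : Arrangement n (w + 1) d)
    (L : Fin (w + 1) → List (Fin n)) (h : Represents π L) (hm : (L 0).length = m) :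
    ∃ π' L', ReflTransGen Step π π' ∧ Represents π' L' ∧ L' 0 = [] := by
  induction m generalizing π L with
  | zero => exact ⟨π, L, .refl, h, List.length_eq_zero_iff.mp hm⟩
  | succ m ih =>
    obtain ⟨x, l, hl⟩ : ∃ x l, L 0 = x :: l := List.exists_cons_of_length_eq_add_one hm
    have hx := (h 0 x l.length).mp (by simp [hl])
    have hroom : ∃ j : Fin w, (L j.succ).length < d := by
      by_contra! hfull
      have hall : ∀ p : Fin w × Fin d, ∃ o, π.pos o = (p.1.succ, p.2) := by
        rintro ⟨i, j⟩
        have hlt : d - 1 - j.val < (L i.succ).reverse.length := by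
          have := hfull i
          have := j.isLt
          rw [List.length_reverse]
          omega
        obtain ⟨h2, h3⟩ := (h _ _ _).mp (List.getElem?_eq_getElem hlt)
        exact ⟨_, Prod.ext h2 (Fin.ext (by have := j.isLt; simp only; omega))⟩
      choose f hf using hall
      have hinj : Injective (fun q : Option (Fin w × Fin d) => q.elim x f) := by
        rintro (_ | p) (_ | q) e
        · rfl
        · simp only [Option.elim_none, Option.elim_some] at e
          have := hf q
          rw [← e] at this
          rw [this] at hx
          exact absurd hx.1 (Fin.succ_ne_zero _)
        · simp only [Option.elim_none, Option.elim_some] at e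
          have := hf p
          rw [e] at this
          rw [this] at hx
          exact absurd hx.1 (Fin.succ_ne_zero _)
        · simp only [Option.elim_some] at e
          have h1 := hf p
          rw [e, hf q] at h1
          simp only [Prod.mk.injEq, Fin.succ_inj] at h1
          rw [Prod.ext h1.1.symm h1.2.symm]
      have := Fintype.card_le_of_injective _ hinj
      simp at this
      omega
    obtain ⟨j, hj⟩ := hroom
    have hj0 : (0 : Fin (w + 1)) ≠ j.succ := (Fin.succ_ne_zero j).symm
    obtain ⟨π₁, hs, h₁⟩ := h.step
      (L' := update (update L 0 l) j.succ (x :: L j.succ))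
      ⟨0, j.succ, x, hj0, by simp [update_of_ne hj0, hl], by simp, hj,
        fun l h1 h2 => by simp [h1, h2]⟩
    obtain ⟨π', L', hr, hrep, h0⟩ := ih π₁ _ h₁ (by
      rw [update_of_ne hj0, update_self]
      simpa [hl] using hm)
    exact ⟨π', L', .head hs hr, hrep, h0⟩

end Arrangements

section Swaps

variable {k d : ℕ} {α : Type*}

/-- The stacks `S` with the contents of three of them replaced. -/
def put (S : Fin k → List α) (A B E : Fin k) (a b e : List α) : Fin k → List α :=
  update (update (update S A a) B b) E e

section Put

variable (S : Fin k → List α) {A B E : Fin k} (x : α) {a b e : List α}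

theorem move_put_AE (hAB : A ≠ B) (hAE : A ≠ E) (h : e.length < d) :
    Move d (put S A B E (x :: a) b e) (put S A B E a b (x :: e)) := by
  refine ⟨A, E, x, hAE, ?_, ?_, ?_, fun l h1 h2 => ?_⟩ <;>
    simp [put, update_apply, *]

theorem move_put_EA (hAB : A ≠ B) (hAE : A ≠ E) (h : a.length < d) :
    Move d (put S A B E a b (x :: e)) (put S A B E (x :: a) b e) := by
  refine ⟨E, A, x, hAE.symm, ?_, ?_, ?_, fun l h1 h2 => ?_⟩ <;>
    simp [put, update_apply, *]

theorem move_put_AB (hAB : A ≠ B) (hAE : A ≠ E) (hBE : B ≠ E) (h : b.length < d) :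
    Move d (put S A B E (x :: a) b e) (put S A B E a (x :: b) e) := by
  refine ⟨A, B, x, hAB, ?_, ?_, ?_, fun l h1 h2 => ?_⟩ <;>
    simp [put, update_apply, *]

theorem move_put_BA (hAB : A ≠ B) (hAE : A ≠ E) (hBE : B ≠ E) (h : a.length < d) :
    Move d (put S A B E a (x :: b) e) (put S A B E (x :: a) b e) := by
  refine ⟨B, A, x, hAB.symm, ?_, ?_, ?_, fun l h1 h2 => ?_⟩ <;>
    simp [put, update_apply, *]

theorem move_put_BE (hBE : B ≠ E) (h : e.length < d) :
    Move d (put S A B E a (x :: b) e) (put S A B E a b (x :: e)) := by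
  refine ⟨B, E, x, hBE, ?_, ?_, ?_, fun l h1 h2 => ?_⟩ <;>
    simp [put, update_apply, *]

theorem move_put_EB (hBE : B ≠ E) (h : b.length < d) :
    Move d (put S A B E a b (x :: e)) (put S A B E a (x :: b) e) := by
  refine ⟨E, B, x, hBE.symm, ?_, ?_, ?_, fun l h1 h2 => ?_⟩ <;>
    simp [put, update_apply, *]

theorem reach_put_AE (hAB : A ≠ B) (hAE : A ≠ E) (P : List α)
    (h : P.length + e.length ≤ d) :
    ReflTransGen (Move d) (put S A B E (P ++ a) b e) (put S A B E a b (P.reverse ++ e)) := by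
  induction P generalizing e with
  | nil => exact .refl
  | cons x P ih =>
    simp only [List.length_cons] at h
    refine .head (move_put_AE S x hAB hAE (by omega)) ?_
    simpa using ih (e := x :: e) (by simp only [List.length_cons]; omega)

theorem reach_put_EA (hAB : A ≠ B) (hAE : A ≠ E) (P : List α)
    (h : P.length + a.length ≤ d) :
    ReflTransGen (Move d) (put S A B E a b (P ++ e)) (put S A B E (P.reverse ++ a) b e) := by
  induction P generalizing a with
  | nil => exact .refl
  | cons x P ih =>
    simp only [List.length_cons] at h
    refine .head (move_put_EA S x hAB hAE (by omega)) ?_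
    simpa using ih (a := x :: a) (by simp only [List.length_cons]; omega)

theorem reach_put_swap_adjacent (hAB : A ≠ B) (hAE : A ≠ E) (hBE : B ≠ E) (P Q : List α)
    (x y : α) (hA : (P ++ x :: y :: Q).length ≤ d) (hb : b.length ≤ d) (hb0 : b ≠ []) :
    ReflTransGen (Move d) (put S A B E (P ++ x :: y :: Q) b [])
      (put S A B E (P ++ y :: x :: Q) b []) := by
  obtain ⟨z, b, rfl⟩ := List.exists_cons_of_ne_nil hb0
  simp only [List.length_append, List.length_cons] at hA hb
  refine (reach_put_AE S hAB hAE P (by simp; omega)).trans ?_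
  refine .head (move_put_BE S z hBE (by simp; omega)) ?_
  refine .head (move_put_AB S x hAB hAE hBE (by omega)) ?_
  refine .head (move_put_AE S y hAB hAE (by simp; omega)) ?_
  refine .head (move_put_BA S x hAB hAE hBE (by omega)) ?_
  refine .head (move_put_EA S y hAB hAE (by simp; omega)) ?_
  refine .head (move_put_EB S z hBE (by omega)) ?_
  simpa using reach_put_EA S (e := []) (b := z :: b) (a := y :: x :: Q) hAB hAE P.reverse
    (by simp; omega)

theorem reach_put_swap_tops (hAB : A ≠ B) (hAE : A ≠ E) (hBE : B ≠ E) (x y : α)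
    (hA : (x :: a).length ≤ d) (hB : (y :: b).length ≤ d) :
    ReflTransGen (Move d) (put S A B E (x :: a) (y :: b) [])
      (put S A B E (y :: a) (x :: b) []) := by
  simp only [List.length_cons] at hA hB
  refine .head (move_put_AE S x hAB hAE (by simp; omega)) ?_
  refine .head (move_put_BA S y hAB hAE hBE (by omega)) ?_
  exact .single (move_put_EB S x hBE (by omega))

end Put

/-- An empty stack `0` followed by full stacks with contents `g`. -/
def full {w : ℕ} (g : Fin w × Fin d → α) : Fin (w + 1) → List α :=
  Fin.cons [] fun i => List.ofFn fun j => g (i, j)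

theorem full_eq_put {w : ℕ} (g g' : Fin w × Fin d → α) (A B : Fin w) (hAB : A ≠ B)
    (h : ∀ i j, i ≠ A → i ≠ B → g' (i, j) = g (i, j)) :
    full g' = put (full g) A.succ B.succ 0 (List.ofFn fun j => g' (A, j))
      (List.ofFn fun j => g' (B, j)) [] := by
  funext i
  refine Fin.cases ?_ (fun i => ?_) i
  · simp [put, full]
  · by_cases hA : i = A
    · subst hA
      simp [put, full, hAB]
    · by_cases hB : i = B
      · subst hB
        simp [put, full]
      · simp [put, full, hA, hB, h]

theorem reach_full_adjacent {w : ℕ} (hw : 2 ≤ w) (i : Fin w) (j : ℕ) (hj : j + 1 < d)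
    (g : Fin w × Fin d → α) :
    ReflTransGen (Move d) (full g)
      (full (g ∘ Equiv.swap (i, ⟨j, by omega⟩) (i, ⟨j + 1, hj⟩))) := by
  have : Nontrivial (Fin w) := Fin.nontrivial_iff_two_le.mpr hw
  obtain ⟨B, hB⟩ := exists_ne i
  set g' := g ∘ Equiv.swap (i, (⟨j, by omega⟩ : Fin d)) (i, ⟨j + 1, hj⟩) with hg'
  have hoff : ∀ l t, l ≠ i → g' (l, t) = g (l, t) := by
    intro l t hl
    rw [hg', comp_apply, Equiv.swap_apply_of_ne_of_ne] <;> simp [hl]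
  have hne : ∀ t : Fin d, t.val ≠ j → t.val ≠ j + 1 → g' (i, t) = g (i, t) := by
    intro t h1 h2
    rw [hg', comp_apply, Equiv.swap_apply_of_ne_of_ne] <;> simp [Fin.ext_iff, h1, h2]
  have hsplit : ∀ f : Fin d → α, List.ofFn f = (List.ofFn f).take j ++
      f ⟨j, by omega⟩ :: f ⟨j + 1, hj⟩ :: (List.ofFn f).drop (j + 2) := by
    intro f
    conv_lhs => rw [← List.take_append_drop j (List.ofFn f)]
    rw [List.drop_eq_getElem_cons (by simp; omega), List.drop_eq_getElem_cons (by simp; omega)]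
    simp
  have htake : (List.ofFn fun t => g' (i, t)).take j = (List.ofFn fun t => g (i, t)).take j := by
    refine List.ext_getElem (by simp) fun t h1 h2 => ?_
    simp only [List.length_take, List.length_ofFn] at h1
    simp only [List.getElem_take, List.getElem_ofFn]
    exact hne _ (by simp only; omega) (by simp only; omega)
  have hdrop : (List.ofFn fun t => g' (i, t)).drop (j + 2) =
      (List.ofFn fun t => g (i, t)).drop (j + 2) := by
    refine List.ext_getElem (by simp) fun t h1 h2 => ?_
    simp only [List.getElem_drop, List.getElem_ofFn]
    exact hne _ (by simp only; omega) (by simp only; omega)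
  have hBfun : (fun t => g' (B, t)) = fun t => g (B, t) := funext fun t => hoff B t hB
  rw [full_eq_put g g' i B hB.symm fun l t hl _ => hoff l t hl, hBfun,
    hsplit fun t => g' (i, t), htake, hdrop]
  conv_lhs => rw [full_eq_put g g i B hB.symm fun _ _ _ _ => rfl, hsplit fun t => g (i, t)]
  have e1 : g' (i, ⟨j, by omega⟩) = g (i, ⟨j + 1, hj⟩) := by simp [hg']
  have e2 : g' (i, ⟨j + 1, hj⟩) = g (i, ⟨j, by omega⟩) := by simp [hg']
  rw [e1, e2]
  refine reach_put_swap_adjacent _ (by simpa using hB.symm) (Fin.succ_ne_zero _)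
    (Fin.succ_ne_zero _) _ _ _ _ ?_ (by simp) ?_
  · rw [← hsplit fun t => g (i, t)]
    simp
  · rw [Ne, List.ofFn_eq_nil_iff]
    omega

theorem reach_full_tops {w m : ℕ} (i i' : Fin w) (hi : i ≠ i') (g : Fin w × Fin (m + 1) → α) :
    ReflTransGen (Move (m + 1)) (full g) (full (g ∘ Equiv.swap (i, 0) (i', 0))) := by
  set g' := g ∘ Equiv.swap (i, (0 : Fin (m + 1))) (i', 0) with hg'
  have hoff : ∀ l t, l ≠ i → l ≠ i' → g' (l, t) = g (l, t) := by
    intro l t h1 h2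
    rw [hg', comp_apply, Equiv.swap_apply_of_ne_of_ne] <;> simp [h1, h2]
  have hne : ∀ l (t : Fin m), g' (l, t.succ) = g (l, t.succ) := by
    intro l t
    rw [hg', comp_apply, Equiv.swap_apply_of_ne_of_ne] <;> simp
  have e1 : g' (i, 0) = g (i', 0) := by simp [hg']
  have e2 : g' (i', 0) = g (i, 0) := by simp [hg']
  rw [full_eq_put g g' i i' hi hoff]
  conv_lhs => rw [full_eq_put g g i i' hi fun _ _ _ _ => rfl]
  simp only [List.ofFn_succ, hne, e1, e2]
  exact reach_put_swap_tops _ (by simpa using hi) (Fin.succ_ne_zero _) (Fin.succ_ne_zero _)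
    _ _ (by simp) (by simp)

theorem reach_full_swap_trans {w : ℕ} {p q r : Fin w × Fin d}
    (hpq : ∀ g : Fin w × Fin d → α,
      ReflTransGen (Move d) (full g) (full (g ∘ Equiv.swap p q)))
    (hqr : ∀ g : Fin w × Fin d → α,
      ReflTransGen (Move d) (full g) (full (g ∘ Equiv.swap q r)))
    (g : Fin w × Fin d → α) : ReflTransGen (Move d) (full g) (full (g ∘ Equiv.swap p r)) := by
  by_cases h1 : p = q
  · subst h1; exact hqr g
  by_cases h2 : p = r
  · subst h2; simpa using ReflTransGen.refl
  by_cases h3 : q = r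
  · subst h3; exact hpq g
  have := ((hpq g).trans (hqr _)).trans (hpq _)
  convert this using 2
  rw [comp_assoc, comp_assoc, ← Equiv.Perm.coe_mul, ← Equiv.Perm.coe_mul]
  rw [Equiv.swap_comm p q, Equiv.swap_comm q r, ← Equiv.swap_mul_swap_mul_swap (Ne.symm h3)
    (Ne.symm h2), mul_assoc]

theorem reach_full_swap {w : ℕ} (hw : 2 ≤ w) (p q : Fin w × Fin d)
    (g : Fin w × Fin d → α) : ReflTransGen (Move d) (full g) (full (g ∘ Equiv.swap p q)) := by
  obtain _ | m := d
  · exact p.2.elim0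
  have hcol : ∀ (i : Fin w) (j : ℕ) (hj : j < m + 1) (g : Fin w × Fin (m + 1) → α),
      ReflTransGen (Move (m + 1)) (full g) (full (g ∘ Equiv.swap (i, 0) (i, ⟨j, hj⟩))) := by
    intro i j
    induction j with
    | zero => intro hj g; simpa using ReflTransGen.refl
    | succ j ih =>
      intro hj
      exact reach_full_swap_trans (ih (by omega)) (reach_full_adjacent hw i j hj)
  have htop : ∀ (i i' : Fin w) (g : Fin w × Fin (m + 1) → α),
      ReflTransGen (Move (m + 1)) (full g) (full (g ∘ Equiv.swap (i, 0) (i', 0))) := by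
    intro i i' g
    by_cases h : i = i'
    · subst h; simpa using ReflTransGen.refl
    · exact reach_full_tops i i' h g
  refine reach_full_swap_trans (q := (p.1, 0)) (fun g => ?_)
    (reach_full_swap_trans (q := (q.1, 0)) (htop _ _) (hcol q.1 q.2 q.2.isLt)) g
  rw [Equiv.swap_comm]
  exact hcol p.1 p.2 p.2.isLt g

theorem reach_full_perm {w : ℕ} (hw : 2 ≤ w) (σ : Equiv.Perm (Fin w × Fin d))
    (g : Fin w × Fin d → α) : ReflTransGen (Move d) (full g) (full (g ∘ σ)) := by
  induction σ using Equiv.Perm.swap_induction_on generalizing g with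
  | one => exact .refl
  | swap_mul f x y _ ih =>
    rw [Equiv.Perm.coe_mul, ← comp_assoc]
    exact (reach_full_swap hw x y g).trans (ih _)

end Swaps

theorem exists_full {n w d : ℕ} (π : Arrangement n (w + 1) d) (L : Fin (w + 1) → List (Fin n))
    (h : Represents π L) (h0 : L 0 = []) :
    ∃ (g : Fin w × Fin d → Option (Fin n)) (e : Fin n → Fin w × Fin d), Injective e ∧
      (∀ o, g (e o) = some o) ∧ (∀ p, p ∉ Set.range e → g p = none) ∧
      (fun i => (full g i).reduceOption) = L := by
  have hstack : ∀ o, (π.pos o).1 ≠ 0 := by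
    intro o ho
    have hlt := (π.pos o).2.isLt
    have := (h 0 o (d - 1 - (π.pos o).2.val)).mpr ⟨ho, by omega⟩
    simp [h0] at this
  let pad : Fin w → List (Option (Fin n)) := fun i =>
    List.replicate (d - (L i.succ).length) none ++ (L i.succ).map some
  have hpad : ∀ i, (pad i).length = d := fun i => by
    have := h.length_le i.succ
    simp only [pad, List.length_append, List.length_replicate, List.length_map]
    omega
  let g : Fin w × Fin d → Option (Fin n) := fun p =>
    (pad p.1)[p.2.val]'(by rw [hpad]; exact p.2.isLt)
  have hg : ∀ p o, g p = some o ↔ π.pos o = (p.1.succ, p.2) := by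
    rintro ⟨i, j⟩ o
    have hj := j.isLt
    have hlen := h.length_le i.succ
    have hiff : π.pos o = (i.succ, j) ↔ (L i.succ).reverse[d - 1 - j.val]? = some o := by
      rw [h, Prod.ext_iff, Fin.ext_iff (a := (π.pos o).2)]
      simp only
      have := (π.pos o).2.isLt
      refine and_congr_right fun _ => ?_
      omega
    rw [hiff]
    simp only [g, pad]
    rw [List.getElem_append]
    split_ifs with hlt
    · simp only [List.length_replicate] at hlt
      rw [List.getElem?_eq_none (by simp; omega)]
      simp
    · simp only [List.length_replicate] at hlt
      rw [List.getElem?_reverse (by omega), List.getElem_map, Option.some.injEq,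
        List.getElem?_eq_some_iff]
      simp only [List.length_replicate]
      have : (L i.succ).length - 1 - (d - 1 - j.val) = j.val - (d - (L i.succ).length) := by
        omega
      simp only [this]
      exact ⟨fun e => ⟨by omega, e⟩, fun ⟨_, e⟩ => e⟩
  let e : Fin n → Fin w × Fin d := fun o => ((π.pos o).1.pred (hstack o), (π.pos o).2)
  have hge : ∀ o, g (e o) = some o := fun o => (hg _ _).mpr (by simp [e])
  refine ⟨g, e, fun o o' hoo => ?_, hge, fun p hp => ?_, ?_⟩
  · exact Option.some.inj ((hge o).symm.trans ((congrArg g hoo).trans (hge o')))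
  · by_contra hne
    obtain ⟨o, ho⟩ := Option.ne_none_iff_exists'.mp hne
    have := (hg _ _).mp ho
    exact hp ⟨o, by simp [e, this]⟩
  · funext i
    refine Fin.cases ?_ (fun i => ?_) i
    · simp [full, h0]
    · have hofn : (List.ofFn fun j => g (i, j)) = pad i :=
        List.ext_getElem (by simp [hpad]) fun t h1 h2 => by simp [g]
      simp only [full, Fin.cons_succ, hofn, pad]
      simp [List.reduceOption, List.filterMap_map]

end StackRearrangement

open Function StackRearrangement in
/-- For all integers `w ≥ 2`, `d ≥ 1` and all `n ≤ w*d`, every LSR instance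
`(π_I, π_G)` with `n` objects has a solution: `π_G` is reachable from `π_I` by a finite
sequence of permissible pop-and-push actions. -/
theorem lsr_always_feasible (w d n : ℕ) (hw : 2 ≤ w) (hd : 1 ≤ d) (hn : n ≤ w * d)
    (πI πG : Arrangement n (w + 1) d) :
    Relation.ReflTransGen Step πI πG := by
  classical
  obtain ⟨LI, hLI⟩ := exists_represents πI
  obtain ⟨LG, hLG⟩ := exists_represents πG
  obtain ⟨πI', LI', hI, hrI, hI0⟩ := exists_reach_empty hn _ πI LI hLI rfl
  obtain ⟨πG', LG', hG, hrG, hG0⟩ := exists_reach_empty hn _ πG LG hLG rfl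
  obtain ⟨gI, eI, heI, hgI, hnI, hfI⟩ := exists_full πI' LI' hrI hI0
  obtain ⟨gG, eG, heG, hgG, hnG, hfG⟩ := exists_full πG' LG' hrG hG0
  let ε : {p // p ∈ Set.range eG} ≃ {p // p ∈ Set.range eI} :=
    (Equiv.ofInjective eG heG).symm.trans (Equiv.ofInjective eI heI)
  have hσ : gI ∘ ε.extendSubtype = gG := by
    funext p
    rw [comp_apply]
    by_cases hp : p ∈ Set.range eG
    · obtain ⟨o, rfl⟩ := hp
      rw [ε.extendSubtype_apply_of_mem _ ⟨o, rfl⟩, hgG]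
      have : (Equiv.ofInjective eG heG).symm ⟨eG o, ⟨o, rfl⟩⟩ = o :=
        Equiv.ofInjective_symm_apply heG o
      simp only [ε, Equiv.trans_apply, this, Equiv.ofInjective_apply, hgI]
    · rw [hnG p hp, hnI _ (ε.extendSubtype_not_mem p hp)]
  rw [← hfI] at hrI
  obtain ⟨π, hπ, hrπ⟩ := hrI.reach (reach_full_perm hw ε.extendSubtype gI)
  rw [hσ, hfG] at hrπ
  rw [hrπ.eq hrG] at hπ
  exact (hI.trans hπ).trans (reach_symm hG)
end

section
/- There exists a universal constant c > 0 such that for all integers w ≥ 2, d ≥ 1, every LSR instance with n ≤ wd objects has a solution consisting of at most c·w·d² permissible pop-and-push actions. -/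
namespace Arrangement

variable {n k d : ℕ}

theorem ext_pos_s2 {π ρ : Arrangement n k d} (h : π.pos = ρ.pos) : π = ρ := by
  cases π; cases ρ; cases h; rfl

/-- The object `o` is the topmost object of its stack. -/
def IsTop (π : Arrangement n k d) (o : Fin n) : Prop :=
  ∀ o', o' ≠ o → (π.pos o').1 = (π.pos o).1 → (π.pos o).2 < (π.pos o').2

/-- The arrangement obtained by permuting the names of the objects. -/
def permute (π : Arrangement n k d) (σ : Equiv.Perm (Fin n)) : Arrangement n k d where
  pos := π.pos ∘ σ
  inj := π.inj.comp σ.injective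
  contig o j h := by
    obtain ⟨o', ho'⟩ := π.contig (σ o) j h
    exact ⟨σ.symm o', by simpa using ho'⟩

@[simp] theorem permute_pos (π : Arrangement n k d) (σ : Equiv.Perm (Fin n)) (o : Fin n) :
    (π.permute σ).pos o = π.pos (σ o) := rfl

theorem range_permute (π : Arrangement n k d) (σ : Equiv.Perm (Fin n)) :
    Set.range (π.permute σ).pos = Set.range π.pos :=
  σ.surjective.range_comp π.pos

theorem IsTop.permute {π : Arrangement n k d} {o : Fin n} (σ : Equiv.Perm (Fin n))
    (h : π.IsTop (σ o)) : (π.permute σ).IsTop o :=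
  fun o' ho' hs => h (σ o') (fun e => ho' (σ.injective e)) hs

theorem exists_isTop (π : Arrangement n k d) (o : Fin n) :
    ∃ t, (π.pos t).1 = (π.pos o).1 ∧ π.IsTop t := by
  obtain ⟨t, ht, hmin⟩ := Finset.exists_min_image
    (Finset.univ.filter fun t => (π.pos t).1 = (π.pos o).1) (fun t => (π.pos t).2) ⟨o, by simp⟩
  simp only [Finset.mem_filter, Finset.mem_univ, true_and] at ht hmin
  refine ⟨t, ht, fun o' hne hs => lt_of_le_of_ne (hmin o' (hs.trans ht)) fun e => hne ?_⟩
  exact π.inj (Prod.ext hs e.symm)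

/-- A stack with a free slot has a deepest free slot. -/
theorem exists_deepest_free (π : Arrangement n k d) (j : Fin k) (s₀ : Fin d)
    (h : (j, s₀) ∉ Set.range π.pos) :
    ∃ s, s₀ ≤ s ∧ (j, s) ∉ Set.range π.pos ∧ ∀ s', s < s' → (j, s') ∈ Set.range π.pos := by
  classical
  obtain ⟨s, hs, hmax⟩ := Finset.exists_max_image
    (Finset.univ.filter fun s => (j, s) ∉ Set.range π.pos) id ⟨s₀, by simpa using h⟩
  simp only [Finset.mem_filter, Finset.mem_univ, true_and, id] at hs hmax
  refine ⟨s, hmax s₀ h, hs, fun s' hlt => ?_⟩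
  by_contra hc
  exact absurd (hmax s' hc) (not_le.mpr hlt)

theorem exists_push_s2 (π : Arrangement n k d) {o : Fin n} (ho : π.IsTop o) {j : Fin k} {s : Fin d}
    (hj : j ≠ (π.pos o).1) (hs : (j, s) ∉ Set.range π.pos)
    (hb : ∀ s', s < s' → (j, s') ∈ Set.range π.pos) :
    ∃ π' : Arrangement n k d, Step π π' ∧ π'.pos = Function.update π.pos o (j, s) := by
  refine ⟨⟨Function.update π.pos o (j, s), ?_, ?_⟩, ⟨o, ?_, ho, ?_⟩, rfl⟩
  · intro a b hab
    by_cases ha : a = o <;> by_cases hb' : b = o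
    · rw [ha, hb']
    · subst ha
      rw [Function.update_self, Function.update_of_ne hb'] at hab
      exact absurd ⟨b, hab.symm⟩ hs
    · subst hb'
      rw [Function.update_self, Function.update_of_ne ha] at hab
      exact absurd ⟨a, hab⟩ hs
    · rw [Function.update_of_ne ha, Function.update_of_ne hb'] at hab
      exact π.inj hab
  · intro a t hat
    by_cases ha : a = o
    · subst ha
      rw [Function.update_self] at hat ⊢
      rcases eq_or_lt_of_le hat with rfl | hlt
      · exact ⟨a, by simp⟩
      · obtain ⟨o', ho'⟩ := hb t hlt
        refine ⟨o', ?_⟩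
        rw [Function.update_of_ne, ho']
        rintro rfl
        exact hj (by rw [ho'])
    · rw [Function.update_of_ne ha] at hat ⊢
      obtain ⟨o', ho'⟩ := π.contig a t hat
      refine ⟨o', ?_⟩
      rw [Function.update_of_ne, ho']
      rintro rfl
      have := ho a ha (by rw [ho'])
      rw [ho'] at this
      exact absurd hat (not_le.mpr this)
  · simpa using hj
  · intro o' ho'
    simp [Function.update_of_ne ho']

end Arrangement

open Arrangement

section Reachability

variable {n k d : ℕ}

theorem Step.symm {π ρ : Arrangement n k d} (h : Step π ρ) : Step ρ π := by
  obtain ⟨o, hne, -, hrest⟩ := h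
  refine ⟨o, hne.symm, fun o' ho' hs => ?_, fun o' ho' => (hrest o' ho').symm⟩
  by_contra hlt
  rw [hrest o' ho', not_lt] at hlt
  rw [hrest o' ho'] at hs
  obtain ⟨q, hq⟩ := π.contig o' _ hlt
  rw [hs] at hq
  have hqo : q ≠ o := by
    rintro rfl
    exact hne (by rw [hq])
  exact hqo (ρ.inj ((hrest q hqo).trans hq))

theorem Step.permute {π ρ : Arrangement n k d} (h : Step π ρ) (σ : Equiv.Perm (Fin n)) :
    Step (π.permute σ) (ρ.permute σ) := by
  obtain ⟨o, hne, htop, hrest⟩ := h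
  refine ⟨σ.symm o, by simpa using hne, fun o' ho' hs => ?_, fun o' ho' => ?_⟩
  · have := htop (σ o') (fun e => ho' (by simp [← e])) (by simpa using hs)
    simpa using this
  · exact hrest (σ o') (fun e => ho' (by simp [← e]))

theorem Reach.refl (π : Arrangement n k d) : Reach π π 0 :=
  ⟨fun _ => π, rfl, rfl, fun _ h => absurd h (Nat.not_lt_zero _)⟩

theorem Step.reach {π ρ : Arrangement n k d} (h : Step π ρ) : Reach π ρ 1 := by
  refine ⟨fun t => if t = 0 then π else ρ, by simp, by simp, fun t ht => ?_⟩
  obtain rfl : t = 0 := by omega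
  simpa using h

theorem Reach.trans {π ρ τ : Arrangement n k d} {a b : ℕ} (h₁ : Reach π ρ a)
    (h₂ : Reach ρ τ b) : Reach π τ (a + b) := by
  obtain ⟨f, f0, fa, hf⟩ := h₁
  obtain ⟨g, g0, gb, hg⟩ := h₂
  refine ⟨fun t => if t ≤ a then f t else g (t - a), by simpa using f0, ?_, fun t ht => ?_⟩
  · rcases Nat.eq_zero_or_pos b with rfl | hb
    · simp [fa, ← gb, g0]
    · simp [show ¬ b = 0 by omega, gb]
  · rcases lt_trichotomy t a with h | rfl | h
    · simpa [h.le, Nat.succ_le_of_lt h] using hf t h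
    · simpa [fa, ← g0] using hg 0 (by omega)
    · have := hg (t - a) (by omega)
      simpa [show ¬ t ≤ a by omega, show ¬ t + 1 ≤ a by omega,
        show t + 1 - a = t - a + 1 by omega] using this

theorem Reach.symm {π ρ : Arrangement n k d} {m : ℕ} (h : Reach π ρ m) : Reach ρ π m := by
  obtain ⟨f, f0, fm, hf⟩ := h
  refine ⟨fun t => f (m - t), by simpa using fm, by simpa using f0, fun t ht => ?_⟩
  have := (hf (m - (t + 1)) (by omega)).symm
  rwa [show m - (t + 1) + 1 = m - t by omega] at this

theorem Reach.permute {π ρ : Arrangement n k d} {m : ℕ} (h : Reach π ρ m)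
    (σ : Equiv.Perm (Fin n)) : Reach (π.permute σ) (ρ.permute σ) m := by
  obtain ⟨f, rfl, rfl, hf⟩ := h
  exact ⟨fun t => (f t).permute σ, rfl, rfl, fun t ht => (hf t ht).permute σ⟩

/-- `ρ` can be obtained from `π` by at most `m` actions. -/
def ReachLe (π ρ : Arrangement n k d) (m : ℕ) : Prop := ∃ l ≤ m, Reach π ρ l

theorem ReachLe.mono {π ρ : Arrangement n k d} {a b : ℕ} (h : ReachLe π ρ a) (hab : a ≤ b) :
    ReachLe π ρ b :=
  let ⟨l, hl, hr⟩ := h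
  ⟨l, hl.trans hab, hr⟩

theorem ReachLe.refl (π : Arrangement n k d) (m : ℕ) : ReachLe π π m :=
  ⟨0, Nat.zero_le _, .refl π⟩

theorem Step.reachLe {π ρ : Arrangement n k d} (h : Step π ρ) : ReachLe π ρ 1 :=
  ⟨1, le_rfl, h.reach⟩

theorem ReachLe.trans {π ρ τ : Arrangement n k d} {a b : ℕ} (h₁ : ReachLe π ρ a)
    (h₂ : ReachLe ρ τ b) : ReachLe π τ (a + b) :=
  let ⟨l₁, hl₁, hr₁⟩ := h₁
  let ⟨l₂, hl₂, hr₂⟩ := h₂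
  ⟨l₁ + l₂, Nat.add_le_add hl₁ hl₂, hr₁.trans hr₂⟩

theorem ReachLe.symm {π ρ : Arrangement n k d} {a : ℕ} (h : ReachLe π ρ a) : ReachLe ρ π a :=
  let ⟨l, hl, hr⟩ := h
  ⟨l, hl, hr.symm⟩

/-- A permutation that can be realised after a detour can be realised directly, by undoing the
detour afterwards. -/
theorem ReachLe.conj {π ρ : Arrangement n k d} {a b : ℕ} {σ : Equiv.Perm (Fin n)}
    (h₁ : ReachLe π ρ a) (h₂ : ReachLe ρ (ρ.permute σ) b) :
    ReachLe π (π.permute σ) (a + b + a) :=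
  let ⟨l, hl, hr⟩ := h₁
  (h₁.trans h₂).trans ⟨l, hl, (hr.permute σ).symm⟩

end Reachability

section Swaps

variable {n k d : ℕ}

theorem reachLe_swap_of_isTop (π : Arrangement n k d) {x b : Fin n} {E : Fin k} {s₀ : Fin d}
    (hx : π.IsTop x) (hb : π.IsTop b) (hxb : (π.pos x).1 ≠ (π.pos b).1)
    (hEx : E ≠ (π.pos x).1) (hEb : E ≠ (π.pos b).1) (hs₀ : (E, s₀) ∉ Set.range π.pos) :
    ReachLe π (π.permute (Equiv.swap x b)) 3 := by
  have hne : x ≠ b := by rintro rfl; exact hxb rfl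
  obtain ⟨s, -, hs, hbelow⟩ := π.exists_deepest_free E s₀ hs₀
  obtain ⟨π₁, h₁, p₁⟩ := π.exists_push_s2 hb hEb hs hbelow
  have hb' : (π.permute (Equiv.swap x b)).IsTop b := IsTop.permute _ (by simpa using hx)
  obtain ⟨π₂, h₂, p₂⟩ := (π.permute (Equiv.swap x b)).exists_push_s2 hb' (j := E) (s := s)
    (by simpa using hEx) (by rwa [range_permute]) (by rwa [range_permute])
  have hmid : Step π₁ π₂ := by
    refine ⟨x, ?_, fun o ho hso => ?_, fun o ho => ?_⟩
    · rw [p₁, p₂, Function.update_of_ne hne, Function.update_of_ne hne]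
      simpa using hxb.symm
    · rw [p₁, Function.update_of_ne hne] at hso ⊢
      by_cases hob : o = b
      · subst hob
        rw [Function.update_self] at hso
        exact absurd hso hEx
      · rw [Function.update_of_ne hob] at hso ⊢
        exact hx o ho hso
    · rw [p₁, p₂]
      by_cases hob : o = b
      · subst hob
        simp
      · rw [Function.update_of_ne hob, Function.update_of_ne hob, permute_pos,
          Equiv.swap_apply_of_ne_of_ne ho hob]
  exact (h₁.reachLe.trans hmid.reachLe).trans h₂.symm.reachLe

/-- Swapping an object `x` with the top `b` of another stack, when at most `m` objects lie above
`x` and more than `m` slots are free in a third stack. -/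
theorem reachLe_swap_of_above (m : ℕ) (hm : m < d) (π : Arrangement n k d) {x b : Fin n}
    {E : Fin k} (hb : π.IsTop b) (hxb : (π.pos x).1 ≠ (π.pos b).1)
    (hEx : E ≠ (π.pos x).1) (hEb : E ≠ (π.pos b).1)
    (habove : ∀ o, (π.pos o).1 = (π.pos x).1 → ((π.pos x).2 : ℕ) ≤ (π.pos o).2 + m)
    (hfree : ∀ o, (π.pos o).1 = E → m < ((π.pos o).2 : ℕ)) :
    ReachLe π (π.permute (Equiv.swap x b)) (2 * m + 3) := by
  have hslot : (E, (⟨m, hm⟩ : Fin d)) ∉ Set.range π.pos := by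
    rintro ⟨o, ho⟩
    have := hfree o (by rw [ho])
    simp [ho] at this
  induction m generalizing π with
  | zero =>
    refine reachLe_swap_of_isTop π (fun o ho hs => ?_) hb hxb hEx hEb hslot
    refine lt_of_le_of_ne ?_ fun e => ho (π.inj (Prod.ext hs e.symm))
    simpa using habove o hs
  | succ m ih =>
    by_cases h : ∃ o, (π.pos o).1 = (π.pos x).1 ∧ ((π.pos o).2 : ℕ) + (m + 1) = (π.pos x).2
    · obtain ⟨o, hos, hod⟩ := h
      have hot : π.IsTop o := by
        intro o' ho' hs
        refine lt_of_le_of_ne ?_ fun e => ho' (π.inj (Prod.ext hs e.symm))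
        have := habove o' (hs.trans hos)
        rw [Fin.le_def]
        omega
      have hxo : x ≠ o := by rintro rfl; omega
      have hbo : b ≠ o := by rintro rfl; exact hxb hos.symm
      obtain ⟨s, hle, hs, hbelow⟩ := π.exists_deepest_free E _ hslot
      have hle' : m + 1 ≤ (s : ℕ) := hle
      obtain ⟨π₁, h₁, p₁⟩ := π.exists_push_s2 hot (by rwa [hos]) hs hbelow
      have px : π₁.pos x = π.pos x := by rw [p₁, Function.update_of_ne hxo]
      have pb : π₁.pos b = π.pos b := by rw [p₁, Function.update_of_ne hbo]
      have po : π₁.pos o = (E, s) := by rw [p₁, Function.update_self]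
      have pr : ∀ q, q ≠ o → π₁.pos q = π.pos q := fun q hq => by
        rw [p₁, Function.update_of_ne hq]
      have hfree₁ : ∀ q, (π₁.pos q).1 = E → m < ((π₁.pos q).2 : ℕ) := by
        intro q hq
        by_cases hqo : q = o
        · rw [hqo, po]
          exact hle'
        · rw [pr q hqo] at hq ⊢
          have := hfree q hq
          omega
      have key := ih (by omega) π₁
        (fun q hq hqs => by
          by_cases hqo : q = o
          · rw [hqo, po, pb] at hqs
            exact absurd hqs hEb
          · rw [pr q hqo, pb] at hqs ⊢
            exact hb q hq hqs)
        (by rwa [px, pb]) (by rwa [px]) (by rwa [pb])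
        (fun q hqs => by
          by_cases hqo : q = o
          · rw [hqo, po, px] at hqs
            exact absurd hqs hEx
          · rw [pr q hqo, px] at hqs ⊢
            have h1 := habove q hqs
            have h2 : ((π.pos q).2 : ℕ) ≠ (π.pos o).2 := fun e =>
              hqo (π.inj (Prod.ext (hqs.trans hos.symm) (Fin.ext e)))
            omega)
        hfree₁
        (by
          rintro ⟨q, hq⟩
          have := hfree₁ q (by rw [hq])
          simp [hq] at this)
      exact (h₁.reachLe.conj key).mono (by omega)
    · push Not at h
      have hfree' : ∀ o, (π.pos o).1 = E → m < ((π.pos o).2 : ℕ) := fun o ho => by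
        have := hfree o ho
        omega
      refine (ih (by omega) π hb hxb hEx hEb (fun o ho => ?_) hfree' ?_).mono (by omega)
      · have h1 := habove o ho
        have h2 := h o ho
        omega
      · rintro ⟨q, hq⟩
        have := hfree' q (by rw [hq])
        simp [hq] at this

theorem reachLe_swap_top (π : Arrangement n k d) {x b : Fin n} {E : Fin k}
    (hE : ∀ o, (π.pos o).1 ≠ E) (hb : π.IsTop b) (hxb : (π.pos x).1 ≠ (π.pos b).1) :
    ReachLe π (π.permute (Equiv.swap x b)) (2 * d + 1) := by
  have hd := (π.pos x).2.isLt
  exact (reachLe_swap_of_above (π.pos x).2 hd π hb hxb (hE x).symm (hE b).symm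
    (fun o _ => Nat.le_add_left _ _) (fun o ho => absurd ho (hE o))).mono (by omega)

theorem reachLe_swap_same_stack (π : Arrangement n k d) {a b t : Fin n} {E : Fin k}
    (hE : ∀ o, (π.pos o).1 ≠ E) (hab : a ≠ b) (hs : (π.pos a).1 = (π.pos b).1)
    (ht : (π.pos t).1 ≠ (π.pos b).1) :
    ReachLe π (π.permute (Equiv.swap a b)) (3 * (2 * d + 1)) := by
  obtain ⟨u, hu, hut⟩ := π.exists_isTop t
  rw [← hu] at ht
  have hau : a ≠ u := by rintro rfl; exact ht hs
  have h₁ := reachLe_swap_top π hE hut ht.symm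
  have h₂ := reachLe_swap_top (π.permute (Equiv.swap b u)) (x := a) (b := b)
    (fun o => hE _) (IsTop.permute _ (by simpa using hut))
    (by simpa [Equiv.swap_apply_of_ne_of_ne hab hau, hs] using ht.symm)
  exact (h₁.conj h₂).mono (by omega)

theorem reachLe_swap (π : Arrangement n k d) {E : Fin k}
    (hE : ∀ o, (π.pos o).1 ≠ E) (htwo : ∀ i, ∃ t, (π.pos t).1 ≠ i) {a b : Fin n} (hab : a ≠ b) :
    ReachLe π (π.permute (Equiv.swap a b)) (5 * (2 * d + 1)) := by
  by_cases hs : (π.pos a).1 = (π.pos b).1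
  · obtain ⟨t, ht⟩ := htwo (π.pos b).1
    exact (reachLe_swap_same_stack π hE hab hs ht).mono (by omega)
  · obtain ⟨u, hu, hut⟩ := π.exists_isTop a
    by_cases hau : a = u
    · subst hau
      rw [Equiv.swap_comm]
      exact (reachLe_swap_top π hE hut (Ne.symm hs)).mono (by omega)
    · have h₁ := reachLe_swap_top π hE hut (x := b) (by rw [hu]; exact Ne.symm hs)
      obtain ⟨t, ht⟩ := htwo (π.pos u).1
      have h₂ := reachLe_swap_same_stack (π.permute (Equiv.swap b u)) (a := a) (b := b)
        (t := Equiv.swap b u t) (fun o => hE _) hab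
        (by simp [Equiv.swap_apply_of_ne_of_ne hab hau, hu]) (by simpa using ht)
      exact (h₁.conj h₂).mono (by omega)

end Swaps

section Shapes

variable {n k d : ℕ}

theorem reachLe_of_range_eq {R : Set (Fin k × Fin d)} {K : ℕ}
    (hK : ∀ π : Arrangement n k d, Set.range π.pos = R → ∀ a b : Fin n, a ≠ b →
      ReachLe π (π.permute (Equiv.swap a b)) K)
    (π ρ : Arrangement n k d) (hπ : Set.range π.pos = R) (hρ : Set.range ρ.pos = R) :
    ReachLe π ρ (n * K) := by
  suffices ∀ m, ∀ π : Arrangement n k d, Set.range π.pos = R →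
      (Finset.univ.filter fun o => π.pos o ≠ ρ.pos o).card ≤ m → ReachLe π ρ (m * K) by
    refine this n π hπ ((Finset.card_le_univ _).trans (by simp))
  intro m
  induction m with
  | zero =>
    intro π _ hcard
    rw [Nat.le_zero, Finset.card_eq_zero, Finset.filter_eq_empty_iff] at hcard
    have : π = ρ := ext_pos_s2 (funext fun o => by simpa using hcard (Finset.mem_univ o))
    exact this ▸ ReachLe.refl _ _
  | succ m ih =>
    intro π hπ hcard
    by_cases hall : ∀ o, π.pos o = ρ.pos o
    · have : π = ρ := ext_pos_s2 (funext hall)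
      exact this ▸ ReachLe.refl _ _
    · push Not at hall
      obtain ⟨a, ha⟩ := hall
      obtain ⟨b, hb⟩ : ρ.pos a ∈ Set.range π.pos := by rw [hπ, ← hρ]; exact ⟨a, rfl⟩
      have hab : a ≠ b := by rintro rfl; exact ha hb
      refine ((hK π hπ a b hab).trans (ih (π.permute (Equiv.swap a b))
        ((range_permute _ _).trans hπ) (Nat.le_of_lt_succ
          (lt_of_lt_of_le (Finset.card_lt_card ?_) hcard)))).mono (by rw [Nat.succ_mul, add_comm])
      rw [Finset.ssubset_iff_of_subset]
      · exact ⟨a, Finset.mem_filter.mpr ⟨Finset.mem_univ _, ha⟩, fun h =>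
          (Finset.mem_filter.mp h).2 (by simpa using hb)⟩
      · intro o ho
        have ho := (Finset.mem_filter.mp ho).2
        refine Finset.mem_filter.mpr ⟨Finset.mem_univ _, ?_⟩
        by_cases hoa : o = a
        · rwa [hoa]
        · by_cases hob : o = b
          · rw [hob, hb]
            exact fun e => hab (ρ.inj e)
          · rwa [permute_pos, Equiv.swap_apply_of_ne_of_ne hoa hob] at ho

theorem Arrangement.range_eq_of_subset {π ρ : Arrangement n k d}
    (h : Set.range π.pos ⊆ Set.range ρ.pos) : Set.range π.pos = Set.range ρ.pos := by
  refine Set.eq_of_subset_of_ncard_le h ?_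
  rw [← Set.image_univ, ← Set.image_univ, Set.ncard_image_of_injective _ π.inj,
    Set.ncard_image_of_injective _ ρ.inj]

/-- Every shape can be reached by moving each object at most once. -/
theorem exists_reachLe_range_eq (π τ : Arrangement n k d) :
    ∃ ρ : Arrangement n k d, Set.range ρ.pos = Set.range τ.pos ∧ ReachLe π ρ n := by
  classical
  suffices ∀ m, ∀ π : Arrangement n k d,
      (Finset.univ.filter fun o => π.pos o ∉ Set.range τ.pos).card ≤ m →
      ∃ ρ : Arrangement n k d, Set.range ρ.pos = Set.range τ.pos ∧ ReachLe π ρ m from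
    this n π ((Finset.card_le_univ _).trans (by simp))
  intro m
  induction m with
  | zero =>
    intro π hcard
    rw [Nat.le_zero, Finset.card_eq_zero, Finset.filter_eq_empty_iff] at hcard
    refine ⟨π, range_eq_of_subset ?_, .refl _ _⟩
    rintro _ ⟨o, rfl⟩
    simpa using hcard (Finset.mem_univ o)
  | succ m ih =>
    intro π hcard
    by_cases hsub : Set.range τ.pos ⊆ Set.range π.pos
    · exact ⟨π, (range_eq_of_subset hsub).symm, .refl _ _⟩
    have hsub' : ¬ Set.range π.pos ⊆ Set.range τ.pos := fun h =>
      hsub (range_eq_of_subset h).symm.subset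
    obtain ⟨_, ⟨o, rfl⟩, ho⟩ := Set.not_subset.mp hsub'
    obtain ⟨_, ⟨q, rfl⟩, hq⟩ := Set.not_subset.mp hsub
    obtain ⟨t, hts, htop⟩ := π.exists_isTop o
    have htle : (π.pos t).2 ≤ (π.pos o).2 := by
      by_cases hto : o = t
      · rw [hto]
      · exact (htop o hto hts.symm).le
    have ht : π.pos t ∉ Set.range τ.pos := by
      rintro ⟨r, hr⟩
      obtain ⟨r', hr'⟩ := τ.contig r (π.pos o).2 (by rwa [hr])
      exact ho ⟨r', by rw [hr', hr, hts]⟩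
    obtain ⟨s, hqs, hs, hbelow⟩ := π.exists_deepest_free (τ.pos q).1 (τ.pos q).2 hq
    have hj : (τ.pos q).1 ≠ (π.pos t).1 := by
      intro e
      rcases le_total (τ.pos q).2 (π.pos o).2 with h | h
      · obtain ⟨r, hr⟩ := τ.contig q _ h
        exact ho ⟨r, by rw [hr, e, hts]⟩
      · obtain ⟨r, hr⟩ := π.contig o _ h
        exact hq ⟨r, by rw [hr, ← hts, ← e]⟩
    obtain ⟨π₁, h₁, p₁⟩ := π.exists_push_s2 htop hj hs hbelow
    have hmem : ((τ.pos q).1, s) ∈ Set.range τ.pos := τ.contig q s hqs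
    obtain ⟨ρ, hρ, hr⟩ := ih π₁ (Nat.le_of_lt_succ
      (lt_of_lt_of_le (Finset.card_lt_card (by
        rw [Finset.ssubset_iff_of_subset]
        · exact ⟨t, Finset.mem_filter.mpr ⟨Finset.mem_univ _, ht⟩, fun h =>
            (Finset.mem_filter.mp h).2 (by rwa [p₁, Function.update_self])⟩
        · intro r hr
          rw [Finset.mem_filter] at hr ⊢
          refine ⟨Finset.mem_univ _, ?_⟩
          by_cases hrt : r = t
          · rwa [hrt]
          · have := hr.2
            rwa [p₁, Function.update_of_ne hrt] at this)) hcard))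
    exact ⟨ρ, hρ, (h₁.reachLe.trans hr).mono (by omega)⟩

/-- The objects are spread evenly over the first `w` of `w + 1` stacks. -/
def Arrangement.balanced (n w d : ℕ) (hw : 0 < w) (hn : n ≤ w * d) :
    Arrangement n (w + 1) d where
  pos o := (⟨o % w, (Nat.mod_lt _ hw).trans (Nat.lt_succ_self w)⟩,
    Fin.rev ⟨o / w, Nat.div_lt_of_lt_mul (o.isLt.trans_le hn)⟩)
  inj a b h := by
    simp only [Prod.mk.injEq, Fin.mk.injEq, Fin.rev_inj] at h
    apply Fin.ext
    rw [← Nat.div_add_mod a w, ← Nat.div_add_mod b w, h.1, h.2]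
  contig o j h := by
    have hj : (Fin.rev j : ℕ) ≤ o / w := by
      have := Fin.rev_le_iff.mp h
      exact this
    have hle : w * (Fin.rev j : ℕ) + o % w ≤ o := by
      calc w * (Fin.rev j : ℕ) + o % w ≤ w * (o / w) + o % w := by gcongr
        _ = o := Nat.div_add_mod _ _
    refine ⟨⟨w * (Fin.rev j : ℕ) + o % w, hle.trans_lt o.isLt⟩, ?_⟩
    have h1 : (w * (Fin.rev j : ℕ) + o % w) / w = (Fin.rev j : ℕ) := by
      rw [Nat.mul_add_div hw, Nat.div_eq_of_lt (Nat.mod_lt _ hw), add_zero]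
    simp only [h1, Nat.mul_add_mod, Nat.mod_mod, Fin.eta, Fin.rev_rev]

theorem reachLe_swap_of_balanced {n w d : ℕ} (hw : 2 ≤ w) (hn : n ≤ w * d)
    (π : Arrangement n (w + 1) d)
    (hπ : Set.range π.pos = Set.range (balanced n w d (by omega) hn).pos)
    (a b : Fin n) (hab : a ≠ b) :
    ReachLe π (π.permute (Equiv.swap a b)) (5 * (2 * d + 1)) := by
  have hn2 : 2 ≤ n := by
    have := a.isLt
    have := b.isLt
    have : (a : ℕ) ≠ b := fun e => hab (Fin.ext e)
    omega
  refine reachLe_swap π (E := Fin.last w) (fun o e => ?_) (fun i => ?_) hab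
  · obtain ⟨q, hq⟩ : π.pos o ∈ Set.range (balanced n w d (by omega) hn).pos := by
      rw [← hπ]
      exact ⟨o, rfl⟩
    have h1 : (q : ℕ) % w = w := by
      rw [← hq] at e
      exact congrArg Fin.val e
    exact absurd h1 (Nat.mod_lt _ (by omega)).ne
  · have hex : ∀ r : Fin n, ∃ t, π.pos t = (balanced n w d (by omega) hn).pos r := fun r => by
      rw [← Set.mem_range, hπ]
      exact ⟨r, rfl⟩
    obtain ⟨t₀, h₀⟩ := hex ⟨0, by omega⟩
    obtain ⟨t₁, h₁⟩ := hex ⟨1, by omega⟩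
    by_contra! hall
    have e : 0 % w = 1 % w := by
      have := (hall t₀).trans (hall t₁).symm
      rw [h₀, h₁] at this
      exact congrArg Fin.val this
    rw [Nat.zero_mod, Nat.mod_eq_of_lt (by omega)] at e
    omega

end Shapes

/-- There is a universal constant `c > 0` such that for all `w ≥ 2`, `d ≥ 1`,
every LSR instance with `n ≤ w*d` objects has a solution with at most `c·w·d²`
permissible pop-and-push actions. -/
theorem lsr_quadratic_upper_bound :
    ∃ c : ℕ, 0 < c ∧ ∀ w d n : ℕ, 2 ≤ w → 1 ≤ d → n ≤ w * d →
      ∀ πI πG : Arrangement n (w + 1) d,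
        ∃ m ≤ c * w * d ^ 2, Reach πI πG m := by
  refine ⟨17, by norm_num, fun w d n hw hd hn πI πG => ?_⟩
  obtain ⟨π₁, e₁, r₁⟩ := exists_reachLe_range_eq πI (balanced n w d (by omega) hn)
  obtain ⟨π₂, e₂, r₂⟩ := exists_reachLe_range_eq πG (balanced n w d (by omega) hn)
  have h := (r₁.trans (reachLe_of_range_eq (reachLe_swap_of_balanced hw hn) π₁ π₂ e₁ e₂)).trans
    r₂.symm
  refine h.mono ?_
  calc n + n * (5 * (2 * d + 1)) + n = n * (10 * d + 7) := by ring
    _ ≤ (w * d) * (17 * d) := Nat.mul_le_mul hn (by omega)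
    _ = 17 * w * d ^ 2 := by ring
end

section
/- There exists a universal constant c > 0 such that for all integers w ≥ 2 and d ≥ 1 the following holds: if π_I and π_G are drawn independently and uniformly at random from the set of arrangements of n = wd objects in which stacks 1 through w are full and stack w+1 is empty, then the expected value of the minimum solution cost of the LSR instance (π_I, π_G) is at least c·w·d. -/
/-- An arrangement of `n = w*d` objects in which stacks `1` through `w` are full and
stack `w+1` is empty. -/
def StdFull {w d : ℕ} (π : Arrangement (w * d) (w + 1) d) : Prop :=
  (∀ o : Fin (w * d), ((π.pos o).1 : ℕ) < w) ∧
  (∀ i : Fin (w + 1), (i : ℕ) < w → ∀ j : Fin d, ∃ o, π.pos o = (i, j))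

/-- The minimum solution cost of the LSR instance `(πI, πG)`. -/
noncomputable def minCost {n k d : ℕ} (πI πG : Arrangement n k d) : ℕ :=
  sInf {m : ℕ | Reach πI πG m}

namespace Arrangement

open Relation

variable {n k d : ℕ}

theorem eq_of_pos_eq {π π' : Arrangement n k d} (h : π.pos = π'.pos) : π = π' := by
  cases π
  cases π'
  cases h
  rfl

/-- Relabel the objects of an arrangement by a permutation. -/
def relabel (π : Arrangement n k d) (σ : Equiv.Perm (Fin n)) : Arrangement n k d where
  pos o := π.pos (σ o)
  inj := π.inj.comp σ.injective
  contig o j h := by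
    obtain ⟨o', ho'⟩ := π.contig (σ o) j h
    exact ⟨σ.symm o', by simpa using ho'⟩

theorem relabel_one (π : Arrangement n k d) : π.relabel 1 = π := rfl

theorem relabel_mul (π : Arrangement n k d) (σ τ : Equiv.Perm (Fin n)) :
    π.relabel (σ * τ) = (π.relabel σ).relabel τ := rfl

theorem step_relabel {π π' : Arrangement n k d} (h : Step π π') (σ : Equiv.Perm (Fin n)) :
    Step (π.relabel σ) (π'.relabel σ) := by
  obtain ⟨o, h1, h2, h3⟩ := h
  refine ⟨σ.symm o, by simpa [relabel] using h1, ?_, ?_⟩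
  · intro o' ho' hs
    have hne : σ o' ≠ o := fun h ↦ ho' (by simp [← h])
    have hs' : (π.pos (σ o')).1 = (π.pos o).1 := by simpa [relabel] using hs
    simpa [relabel] using h2 (σ o') hne hs'
  · intro o' ho'
    exact h3 (σ o') fun h ↦ ho' (by simp [← h])

theorem step_symm {π π' : Arrangement n k d} (h : Step π π') : Step π' π := by
  obtain ⟨o, h1, h2, h3⟩ := h
  refine ⟨o, h1.symm, ?_, fun o' ho' ↦ (h3 o' ho').symm⟩
  intro o' ho' hs
  by_contra! hle
  rw [h3 o' ho'] at hs hle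
  obtain ⟨o'', ho''⟩ := π.contig o' (π'.pos o).2 hle
  have hpos : π.pos o'' = π'.pos o := by rw [ho'', hs]
  by_cases heq : o'' = o
  · subst heq
    exact h1 (by rw [hpos])
  · exact heq (π'.inj (by rw [h3 o'' heq, hpos]))

theorem reflTransGen_relabel {π π' : Arrangement n k d} (h : ReflTransGen Step π π')
    (σ : Equiv.Perm (Fin n)) : ReflTransGen Step (π.relabel σ) (π'.relabel σ) :=
  ReflTransGen.lift (fun ρ : Arrangement n k d ↦ ρ.relabel σ) (fun _ _ h ↦ step_relabel h σ) _ _ h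

theorem reflTransGen_symm {π π' : Arrangement n k d} (h : ReflTransGen Step π π') :
    ReflTransGen Step π' π :=
  have : Std.Symm (Step (n := n) (k := k) (d := d)) := ⟨fun _ _ h ↦ step_symm h⟩
  ReflTransGen.stdSymm.symm _ _ h

theorem exists_reach_of_reflTransGen {π π' : Arrangement n k d}
    (h : ReflTransGen Step π π') : ∃ m, Reach π π' m := by
  induction h using ReflTransGen.head_induction_on with
  | refl => exact ⟨0, fun _ ↦ π', rfl, rfl, by simp⟩
  | @head a _ hs _ ih =>
    obtain ⟨m, f, hf0, hfm, hf⟩ := ih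
    refine ⟨m + 1, fun t ↦ Nat.casesOn t a f, rfl, hfm, ?_⟩
    intro t ht
    cases t with
    | zero => simpa [hf0] using hs
    | succ t => exact hf t (by omega)

/-- The top object `t` of a stack can be moved to the lowest free slot `p` of another stack. -/
theorem exists_step (π : Arrangement n k d) (t : Fin n) (p : Fin k × Fin d)
    (htop : ∀ o', o' ≠ t → (π.pos o').1 = (π.pos t).1 → (π.pos t).2 < (π.pos o').2)
    (hne : p.1 ≠ (π.pos t).1) (hfree : ∀ o, π.pos o ≠ p)
    (hbelow : ∀ j, p.2 < j → ∃ o, π.pos o = (p.1, j)) :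
    ∃ π' : Arrangement n k d, π'.pos = Function.update π.pos t p ∧ Step π π' := by
  refine ⟨⟨Function.update π.pos t p, ?_, ?_⟩, rfl, t, ?_, htop, ?_⟩
  · intro a b hab
    by_cases ha : a = t <;> by_cases hb : b = t
    · rw [ha, hb]
    · subst ha
      rw [Function.update_self, Function.update_of_ne hb] at hab
      exact absurd hab.symm (hfree b)
    · subst hb
      rw [Function.update_self, Function.update_of_ne ha] at hab
      exact absurd hab (hfree a)
    · rw [Function.update_of_ne ha, Function.update_of_ne hb] at hab
      exact π.inj hab
  · intro o j hj
    by_cases ho : o = t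
    · subst ho
      rw [Function.update_self] at hj ⊢
      rcases hj.eq_or_lt with rfl | hlt
      · exact ⟨o, by simp⟩
      · obtain ⟨o', ho'⟩ := hbelow j hlt
        refine ⟨o', ?_⟩
        rw [Function.update_of_ne, ho']
        rintro rfl
        exact hne (by rw [ho'])
    · rw [Function.update_of_ne ho] at hj ⊢
      obtain ⟨o', ho'⟩ := π.contig o j hj
      refine ⟨o', ?_⟩
      rw [Function.update_of_ne, ho']
      rintro rfl
      have h := htop o ho (by rw [ho'])
      rw [ho'] at h
      exact absurd hj (not_le.2 h)
  · simpa using hne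
  · intro o' ho'
    exact Function.update_of_ne ho' _ _

/-- If stack `A` misses its `i` topmost slots, stack `C` holds exactly `i` objects and `b` is at
depth zero of a third stack `B`, any object of `A` can be exchanged with `b`. -/
theorem reflTransGen_relabel_swap {A B C : Fin k} (hAB : A ≠ B) (hAC : A ≠ C) (hBC : B ≠ C)
    (x b : Fin n) (m : ℕ) : ∀ (π : Arrangement n k d) (i : ℕ),
    (∀ j : Fin d, (∃ o, π.pos o = (A, j)) ↔ i ≤ j) →
    (∀ j : Fin d, (∃ o, π.pos o = (C, j)) ↔ d ≤ j + i) →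
    (π.pos b).1 = B → ((π.pos b).2 : ℕ) = 0 → (π.pos x).1 = A → ((π.pos x).2 : ℕ) = i + m →
    ReflTransGen Step π (π.relabel (Equiv.swap x b)) := by
  induction m with
  | zero =>
    intro π i hA hC hb hb0 hx hx0
    have hxb : x ≠ b := by
      rintro rfl
      exact hAB (hx.symm.trans hb)
    have hid : i < d := by have := (π.pos x).2.isLt; omega
    let c : Fin d := ⟨d - 1 - i, by omega⟩
    obtain ⟨π₁, h₁, s₁⟩ := π.exists_step x (C, c)
      (by
        intro o' ho' hs
        have h1 : i ≤ ((π.pos o').2 : ℕ) := (hA _).1 ⟨o', by rw [← hx, ← hs]⟩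
        have h2 : ((π.pos o').2 : ℕ) ≠ (π.pos x).2 := fun h ↦
          ho' (π.inj (Prod.ext hs (Fin.ext h)))
        rw [Fin.lt_def]
        omega)
      (by rw [hx]; exact hAC.symm)
      (by
        intro o ho
        have := (hC c).1 ⟨o, ho⟩
        simp only [c] at this
        omega)
      (by
        intro j hj
        refine (hC j).2 ?_
        simp only [c, Fin.lt_def] at hj
        omega)
    have e₁b : π₁.pos b = π.pos b := by rw [h₁, Function.update_of_ne hxb.symm]
    have e₁x : π₁.pos x = (C, c) := by rw [h₁, Function.update_self]
    have e₁ : ∀ o, o ≠ x → π₁.pos o = π.pos o := fun o ho ↦ by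
      rw [h₁, Function.update_of_ne ho]
    obtain ⟨π₂, h₂, s₂⟩ := π₁.exists_step b (π.pos x)
      (by
        intro o' ho' hs
        have h2 : ((π₁.pos o').2 : ℕ) ≠ (π₁.pos b).2 := fun h ↦
          ho' (π₁.inj (Prod.ext hs (Fin.ext h)))
        rw [e₁b] at h2 ⊢
        rw [Fin.lt_def]
        omega)
      (by rw [e₁b, hb, hx]; exact hAB)
      (by
        intro o ho
        by_cases hox : o = x
        · subst hox
          rw [e₁x] at ho
          exact hAC (by rw [← hx, ← ho])
        · rw [e₁ o hox] at ho
          exact hox (π.inj ho))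
      (by
        intro j hj
        obtain ⟨o, ho⟩ := (hA j).2 (by rw [Fin.lt_def] at hj; omega)
        refine ⟨o, ?_⟩
        rw [e₁ o, ho, hx]
        rintro rfl
        rw [ho] at hj
        exact lt_irrefl _ hj)
    have e₂b : π₂.pos b = π.pos x := by rw [h₂, Function.update_self]
    have e₂x : π₂.pos x = (C, c) := by rw [h₂, Function.update_of_ne hxb, e₁x]
    have e₂ : ∀ o, o ≠ x → o ≠ b → π₂.pos o = π.pos o := fun o ho hob ↦ by
      rw [h₂, Function.update_of_ne hob, e₁ o ho]
    obtain ⟨π₃, h₃, s₃⟩ := π₂.exists_step x (π.pos b)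
      (by
        intro o' ho' hs
        rw [e₂x] at hs ⊢
        by_cases hob : o' = b
        · subst hob
          rw [e₂b, hx] at hs
          exact absurd hs hAC
        · rw [e₂ o' ho' hob] at hs ⊢
          have h1 := (hC (π.pos o').2).1 ⟨o', Prod.ext hs rfl⟩
          simp only [c, Fin.lt_def]
          omega)
      (by rw [e₂x, hb]; exact hBC)
      (by
        intro o ho
        by_cases hox : o = x
        · subst hox
          rw [e₂x] at ho
          exact hBC (by rw [← hb, ← ho])
        · by_cases hob : o = b
          · subst hob
            rw [e₂b] at ho
            exact hox (π.inj ho).symm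
          · rw [e₂ o hox hob] at ho
            exact hob (π.inj ho))
      (by
        intro j hj
        obtain ⟨o, ho⟩ := π.contig b j hj.le
        refine ⟨o, ?_⟩
        rw [e₂ o, ho]
        · rintro rfl
          exact hAB (by rw [← hx, ho, hb])
        · rintro rfl
          rw [ho] at hj
          exact lt_irrefl _ hj)
    have hfin : π₃ = π.relabel (Equiv.swap x b) := by
      refine eq_of_pos_eq (funext fun o ↦ ?_)
      change π₃.pos o = π.pos (Equiv.swap x b o)
      by_cases hox : o = x
      · subst hox
        rw [h₃, Function.update_self, Equiv.swap_apply_left]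
      · rw [h₃, Function.update_of_ne hox]
        by_cases hob : o = b
        · subst hob
          rw [e₂b, Equiv.swap_apply_right]
        · rw [e₂ o hox hob, Equiv.swap_apply_of_ne_of_ne hox hob]
    exact hfin ▸ ((ReflTransGen.single s₁).tail s₂).tail s₃
  | succ m ih =>
    intro π i hA hC hb hb0 hx hx0
    have hid : i + 1 < d := by have := (π.pos x).2.isLt; omega
    obtain ⟨t, ht⟩ := (hA ⟨i, by omega⟩).2 le_rfl
    have htx : x ≠ t := by
      rintro rfl
      rw [ht] at hx0
      simp only at hx0
      omega
    have htb : b ≠ t := by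
      rintro rfl
      rw [ht] at hb
      exact hAB hb
    let c : Fin d := ⟨d - 1 - i, by omega⟩
    obtain ⟨π₁, h₁, s₁⟩ := π.exists_step t (C, c)
      (by
        intro o' ho' hs
        have h1 : i ≤ ((π.pos o').2 : ℕ) := (hA _).1 ⟨o', Prod.ext (by rw [hs, ht]) rfl⟩
        have h2 : ((π.pos o').2 : ℕ) ≠ (π.pos t).2 := fun h ↦
          ho' (π.inj (Prod.ext hs (Fin.ext h)))
        rw [ht] at h2 ⊢
        rw [Fin.lt_def]
        simp only at h2 ⊢
        omega)
      (by rw [ht]; exact hAC.symm)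
      (by
        intro o ho
        have := (hC c).1 ⟨o, ho⟩
        simp only [c] at this
        omega)
      (by
        intro j hj
        refine (hC j).2 ?_
        simp only [c, Fin.lt_def] at hj
        omega)
    have e₁t : π₁.pos t = (C, c) := by rw [h₁, Function.update_self]
    have e₁ : ∀ o, o ≠ t → π₁.pos o = π.pos o := fun o ho ↦ by
      rw [h₁, Function.update_of_ne ho]
    have key := ih π₁ (i + 1)
      (by
        intro j
        constructor
        · rintro ⟨o, ho⟩
          have hot : o ≠ t := by
            rintro rfl
            rw [e₁t] at ho
            exact hAC (by simpa using (congrArg Prod.fst ho).symm)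
          rw [e₁ o hot] at ho
          have h1 := (hA j).1 ⟨o, ho⟩
          have h2 : (j : ℕ) ≠ i := fun h ↦
            hot (π.inj (by rw [ho, ht]; exact Prod.ext rfl (Fin.ext h)))
          omega
        · intro h
          obtain ⟨o, ho⟩ := (hA j).2 (by omega)
          refine ⟨o, ?_⟩
          rw [e₁ o, ho]
          rintro rfl
          rw [ht] at ho
          have := congrArg (fun p ↦ (p.2 : ℕ)) ho
          simp only at this
          omega)
      (by
        intro j
        constructor
        · rintro ⟨o, ho⟩
          by_cases hot : o = t
          · subst hot
            rw [e₁t] at ho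
            have := congrArg (fun p ↦ (p.2 : ℕ)) ho
            simp only [c] at this
            omega
          · rw [e₁ o hot] at ho
            have h1 := (hC j).1 ⟨o, ho⟩
            omega
        · intro h
          by_cases hj : d ≤ j + i
          · obtain ⟨o, ho⟩ := (hC j).2 hj
            refine ⟨o, ?_⟩
            rw [e₁ o, ho]
            rintro rfl
            rw [ht] at ho
            exact hAC (congrArg Prod.fst ho)
          · refine ⟨t, ?_⟩
            rw [e₁t]
            refine Prod.ext rfl (Fin.ext ?_)
            simp only [c]
            omega)
      (by rw [e₁ b htb, hb]) (by rw [e₁ b htb, hb0]) (by rw [e₁ x htx, hx])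
      (by rw [e₁ x htx, hx0]; omega)
    exact ((ReflTransGen.single s₁).trans key).tail (step_relabel (step_symm s₁) _)

/-- The permutations of the objects that can be realized by moves starting from `π`. -/
def realizable (π : Arrangement n k d) : Subgroup (Equiv.Perm (Fin n)) where
  carrier := {σ | ReflTransGen Step π (π.relabel σ)}
  one_mem' := ReflTransGen.refl
  mul_mem' {_ τ} hσ hτ := ReflTransGen.trans hτ (reflTransGen_relabel hσ τ)
  inv_mem' {σ} hσ := by
    have h := reflTransGen_symm (reflTransGen_relabel hσ σ⁻¹)
    rwa [← relabel_mul, mul_inv_cancel, relabel_one] at h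

theorem realizable_eq_top {w d : ℕ} (hw : 2 ≤ w) (hd : 1 ≤ d)
    {π : Arrangement (w * d) (w + 1) d} (hπ : StdFull π) : π.realizable = ⊤ := by
  have hsw : ∀ x b, (π.pos x).1 ≠ (π.pos b).1 → ((π.pos b).2 : ℕ) = 0 →
      Equiv.swap x b ∈ π.realizable := by
    intro x b hne hb
    refine reflTransGen_relabel_swap (C := Fin.last w) hne ?_ ?_ x b (π.pos x).2 π 0 ?_ ?_ rfl hb
      rfl (by omega)
    · intro h
      have := hπ.1 x
      rw [h] at this
      simp at this
    · intro h
      have := hπ.1 b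
      rw [h] at this
      simp at this
    · intro j
      simpa using hπ.2 _ (hπ.1 x) j
    · intro j
      have := j.isLt
      refine ⟨?_, fun h ↦ by omega⟩
      rintro ⟨o, ho⟩
      have := hπ.1 o
      rw [ho] at this
      simp at this
  obtain ⟨b₀, h₀⟩ := hπ.2 ⟨0, by omega⟩ (by simp; omega) ⟨0, by omega⟩
  obtain ⟨b₁, h₁⟩ := hπ.2 ⟨1, by omega⟩ (by simp; omega) ⟨0, by omega⟩
  have h01 : Equiv.swap b₁ b₀ ∈ π.realizable := hsw _ _ (by simp [h₀, h₁]) (by simp [h₀])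
  have conj : ∀ a b c, Equiv.swap a b ∈ π.realizable → Equiv.swap b c ∈ π.realizable →
      Equiv.swap a c ∈ π.realizable := by
    intro a b c hab hbc
    by_cases hac : a = c
    · subst hac
      rw [Equiv.swap_self]
      exact one_mem _
    by_cases hcb : c = b
    · rwa [hcb]
    rw [Equiv.swap_comm] at hab hbc
    rw [← Equiv.swap_mul_swap_mul_swap hcb (Ne.symm hac)]
    exact mul_mem (mul_mem hab hbc) hab
  have hb₀ : ∀ a, Equiv.swap a b₀ ∈ π.realizable := by
    intro a
    by_cases ha : (π.pos a).1 = (π.pos b₀).1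
    · exact conj a b₁ b₀ (hsw _ _ (by rw [ha, h₀, h₁]; simp) (by simp [h₁])) h01
    · exact hsw _ _ ha (by simp [h₀])
  rw [eq_top_iff, ← Equiv.Perm.closure_isSwap, Subgroup.closure_le]
  rintro _ ⟨a, c, -, rfl⟩
  exact conj a b₀ c (hb₀ a) (Equiv.swap_comm c b₀ ▸ hb₀ c)

theorem exists_reach {w d : ℕ} (hw : 2 ≤ w) (hd : 1 ≤ d)
    {π π' : Arrangement (w * d) (w + 1) d} (hπ : StdFull π) (hπ' : StdFull π') :
    ∃ m, Reach π π' m := by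
  choose σ hσ using fun o ↦ hπ.2 (π'.pos o).1 (hπ'.1 o) (π'.pos o).2
  have hinj : Function.Injective σ := fun a b hab ↦ π'.inj (by
    have := hσ a
    rw [hab, hσ b] at this
    exact this.symm)
  let τ := Equiv.ofBijective σ (Finite.injective_iff_bijective.1 hinj)
  have hτ : τ ∈ π.realizable := by
    rw [realizable_eq_top hw hd hπ]
    exact Subgroup.mem_top _
  have he : π.relabel τ = π' := eq_of_pos_eq (funext hσ)
  exact exists_reach_of_reflTransGen (he ▸ hτ)

/-- Each action changes the position of one object only. -/
theorem card_pos_ne_le_of_reach {π π' : Arrangement n k d} {m : ℕ} (h : Reach π π' m) :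
    (Finset.univ.filter fun o ↦ π'.pos o ≠ π.pos o).card ≤ m := by
  obtain ⟨f, rfl, rfl, hf⟩ := h
  induction m with
  | zero => simp
  | succ m ih =>
    obtain ⟨o, -, -, ho⟩ := hf m (Nat.lt_succ_self m)
    refine (Finset.card_le_card (t := insert o
      (Finset.univ.filter fun o ↦ (f m).pos o ≠ (f 0).pos o)) ?_).trans
      ((Finset.card_insert_le _ _).trans
        (Nat.succ_le_succ (ih fun t ht ↦ hf t (ht.trans (Nat.lt_succ_self m)))))
    intro o' ho'
    rw [Finset.mem_insert]
    by_cases h : o' = o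
    · exact Or.inl h
    · right
      simpa [ho o' h] using ho'

theorem card_pos_ne_le_minCost {w d : ℕ} (hw : 2 ≤ w) (hd : 1 ≤ d)
    {π π' : Arrangement (w * d) (w + 1) d} (hπ : StdFull π) (hπ' : StdFull π') :
    (Finset.univ.filter fun o ↦ π'.pos o ≠ π.pos o).card ≤ minCost π π' :=
  card_pos_ne_le_of_reach (Nat.sInf_mem (exists_reach hw hd hπ hπ'))

theorem stdFull_relabel {w d : ℕ} {π : Arrangement (w * d) (w + 1) d} (hπ : StdFull π)
    (σ : Equiv.Perm (Fin (w * d))) : StdFull (π.relabel σ) := by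
  refine ⟨fun o ↦ hπ.1 (σ o), fun i hi j ↦ ?_⟩
  obtain ⟨o, ho⟩ := hπ.2 i hi j
  exact ⟨σ.symm o, by simpa [relabel] using ho⟩

/-- At least half of the full arrangements do not have a given object at a given position. -/
theorem card_le_two_mul_card_pos_ne {w d : ℕ} (hw : 2 ≤ w) (hd : 1 ≤ d)
    {S : Finset (Arrangement (w * d) (w + 1) d)} (hS : ∀ π, π ∈ S ↔ StdFull π)
    (o : Fin (w * d)) (p : Fin (w + 1) × Fin d) :
    S.card ≤ 2 * (S.filter fun π ↦ π.pos o ≠ p).card := by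
  have hn : 1 < w * d := by nlinarith
  have : Nontrivial (Fin (w * d)) := Fin.nontrivial_iff_two_le.2 hn
  obtain ⟨o', ho'⟩ := exists_ne o
  have h := Finset.card_filter_add_card_filter_not (s := S) fun π ↦ π.pos o = p
  have hle : (S.filter fun π ↦ π.pos o = p).card ≤ (S.filter fun π ↦ ¬ π.pos o = p).card := by
    refine Finset.card_le_card_of_injOn (fun π ↦ π.relabel (Equiv.swap o o')) ?_ ?_
    · intro π hπ
      simp only [Finset.coe_filter, Set.mem_ofPred_eq] at hπ ⊢
      refine ⟨(hS _).2 (stdFull_relabel ((hS _).1 hπ.1) _), ?_⟩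
      change ¬ π.pos (Equiv.swap o o' o) = p
      rw [Equiv.swap_apply_left, ← hπ.2]
      exact fun h ↦ ho' (π.inj h)
    · intro π _ π' _ h
      have h' := congrArg (fun ρ ↦ ρ.relabel (Equiv.swap o o')) h
      simpa [← relabel_mul, relabel_one] using h'
  simp only [ne_eq]
  omega

end Arrangement

/-- There is a universal constant `c > 0` such that for all `w ≥ 2`, `d ≥ 1`:
if `π_I` and `π_G` are drawn independently and uniformly at random from the set of
arrangements of `n = w*d` objects with stacks `1..w` full and stack `w+1` empty, the
expected minimum solution cost is at least `c·w·d`.  (The expectation over the uniform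
distribution on `S × S` is the sum of the costs divided by `|S|²`.) -/
theorem lsr_average_case_lower_bound :
    ∃ c : ℝ, 0 < c ∧ ∀ w d : ℕ, 2 ≤ w → 1 ≤ d →
      ∀ S : Finset (Arrangement (w * d) (w + 1) d),
        (∀ π, π ∈ S ↔ StdFull π) →
        c * w * d * ((S.card : ℝ) * (S.card : ℝ)) ≤
          ∑ p ∈ S ×ˢ S, (minCost p.1 p.2 : ℝ) := by
  refine ⟨1 / 2, by norm_num, fun w d hw hd S hS ↦ ?_⟩
  have key : w * d * (S.card * S.card) ≤ 2 * ∑ p ∈ S ×ˢ S, minCost p.1 p.2 := by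
    calc w * d * (S.card * S.card)
        = ∑ _π ∈ S, ∑ _o : Fin (w * d), S.card := by
          simp only [Finset.sum_const, Finset.card_univ, Fintype.card_fin, smul_eq_mul]
          ring
      _ ≤ ∑ π ∈ S, ∑ o : Fin (w * d), 2 * (S.filter fun π' ↦ π'.pos o ≠ π.pos o).card :=
          Finset.sum_le_sum fun π _ ↦ Finset.sum_le_sum fun o _ ↦
            Arrangement.card_le_two_mul_card_pos_ne hw hd hS o (π.pos o)
      _ = 2 * ∑ π ∈ S, ∑ π' ∈ S, (Finset.univ.filter fun o ↦ π'.pos o ≠ π.pos o).card := by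
          simp only [Finset.card_filter, Finset.mul_sum]
          exact Finset.sum_congr rfl fun π _ ↦ Finset.sum_comm
      _ ≤ 2 * ∑ p ∈ S ×ˢ S, minCost p.1 p.2 := by
          rw [Finset.sum_product]
          exact Nat.mul_le_mul_left _ <| Finset.sum_le_sum fun π hπ ↦
            Finset.sum_le_sum fun π' hπ' ↦
              Arrangement.card_pos_ne_le_minCost hw hd ((hS π).1 hπ) ((hS π').1 hπ')
  have key' : (w : ℝ) * d * (S.card * S.card) ≤ 2 * ∑ p ∈ S ×ˢ S, (minCost p.1 p.2 : ℝ) := by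
    exact_mod_cast key
  linarith
end

section
/- For all integers w ≥ 2 and d ≥ 1, there exists an LSR instance (π_I, π_G) with n = wd objects whose every solution consists of at least log((wd)!) / (2·log(w+1)) permissible pop-and-push actions. -/
/-- A labelled move: the label `(i, j)` with `i ≠ j` moves the top object of stack `i` to
stack `j`, and a label `(i, i)` does nothing. -/
def LabelledMove {n k d : ℕ} (c : Fin k × Fin k) (π π' : Arrangement n k d) : Prop :=
  (c.1 = c.2 ∧ π' = π) ∨
  (c.1 ≠ c.2 ∧ ∃ o : Fin n, (π.pos o).1 = c.1 ∧ (π'.pos o).1 = c.2 ∧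
    (∀ o' : Fin n, o' ≠ o → (π.pos o').1 = (π.pos o).1 → (π.pos o).2 < (π.pos o').2) ∧
    (∀ o' : Fin n, o' ≠ o → π'.pos o' = π.pos o'))

/-- If two arrangements agree away from `o` and put `o` into the same stack, then contiguity
forces the depth of `o` in the first to be at least its depth in the second. -/
theorem Arrangement.depth_le_of_agree {n k d : ℕ} {π₁ π₂ : Arrangement n k d} {o : Fin n}
    (hstack : (π₁.pos o).1 = (π₂.pos o).1)
    (hrest : ∀ o', o' ≠ o → π₁.pos o' = π₂.pos o') :
    (π₂.pos o).2 ≤ (π₁.pos o).2 := by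
  by_contra! hlt
  obtain ⟨o', ho'⟩ := π₁.contig o (π₂.pos o).2 hlt.le
  have hne : o' ≠ o := by
    rintro rfl
    rw [ho'] at hlt
    exact lt_irrefl _ hlt
  apply hne
  apply π₂.inj
  rw [← hrest o' hne, ho', hstack]

theorem LabelledMove.right_unique {n k d : ℕ} {c : Fin k × Fin k}
    {π π₁ π₂ : Arrangement n k d} (h₁ : LabelledMove c π π₁) (h₂ : LabelledMove c π π₂) :
    π₁ = π₂ := by
  rcases h₁ with ⟨hc, rfl⟩ | ⟨hc, o, hs, ht, htop, hrest⟩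
  · rcases h₂ with ⟨-, rfl⟩ | ⟨hc', -⟩
    · rfl
    · exact absurd hc hc'
  · rcases h₂ with ⟨hc', -⟩ | ⟨-, p, ps, pt, ptop, prest⟩
    · exact absurd hc' hc
    · have hpo : p = o := by
        by_contra hne
        exact lt_asymm (htop p hne (ps.trans hs.symm))
          (ptop o (Ne.symm hne) (hs.trans ps.symm))
      subst hpo
      have hagree : ∀ o', o' ≠ p → π₁.pos o' = π₂.pos o' :=
        fun o' h => (hrest o' h).trans (prest o' h).symm
      have hstack : (π₁.pos p).1 = (π₂.pos p).1 := ht.trans pt.symm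
      refine Arrangement.ext_pos fun o' => ?_
      by_cases ho : o' = p
      · subst ho
        exact Prod.ext hstack (le_antisymm
          (Arrangement.depth_le_of_agree hstack.symm fun q hq => (hagree q hq).symm)
          (Arrangement.depth_le_of_agree hstack hagree))
      · exact hagree o' ho

theorem Step.exists_labelledMove {n k d : ℕ} {π π' : Arrangement n k d} (h : Step π π') :
    ∃ c, LabelledMove c π π' := by
  obtain ⟨o, hne, htop, hrest⟩ := h
  exact ⟨((π.pos o).1, (π'.pos o).1), Or.inr ⟨hne.symm, o, rfl, rfl, htop, hrest⟩⟩

/-- The arrangement `π'` results from `π` by performing the labels of the word `c` in order. -/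
def FollowsWord {n k d M : ℕ} (c : Fin M → Fin k × Fin k) (π π' : Arrangement n k d) : Prop :=
  ∃ f : ℕ → Arrangement n k d, f 0 = π ∧ f M = π' ∧
    ∀ t : Fin M, LabelledMove (c t) (f t) (f (t + 1))

theorem FollowsWord.right_unique {n k d M : ℕ} {c : Fin M → Fin k × Fin k}
    {π π₁ π₂ : Arrangement n k d} (h₁ : FollowsWord c π π₁) (h₂ : FollowsWord c π π₂) :
    π₁ = π₂ := by
  obtain ⟨f, f0, rfl, hf⟩ := h₁
  obtain ⟨g, g0, rfl, hg⟩ := h₂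
  have key : ∀ t, t ≤ M → f t = g t := by
    intro t
    induction t with
    | zero => exact fun _ => f0.trans g0.symm
    | succ t ih =>
      intro ht
      have h := hf ⟨t, ht⟩
      simp only [ih (Nat.le_of_succ_le ht)] at h
      exact h.right_unique (hg ⟨t, ht⟩)
  exact key M le_rfl

/-- Solutions of length at most `M` are encoded by words of length exactly `M`, padding with
labels that do nothing. -/
theorem Reach.exists_followsWord {n k d m M : ℕ} [NeZero k] {π π' : Arrangement n k d}
    (h : Reach π π' m) (hm : m ≤ M) :
    ∃ c : Fin M → Fin k × Fin k, FollowsWord c π π' := by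
  obtain ⟨f, f0, fm, hf⟩ := h
  have hmove : ∀ t : Fin M, ∃ c, LabelledMove c (f (min t m)) (f (min (t + 1) m)) := by
    intro t
    by_cases ht : (t : ℕ) < m
    · rw [min_eq_left ht.le, min_eq_left (Nat.succ_le_of_lt ht)]
      exact (hf t ht).exists_labelledMove
    · rw [min_eq_right (by omega), min_eq_right (by omega)]
      exact ⟨(0, 0), Or.inl ⟨rfl, rfl⟩⟩
  choose c hc using hmove
  exact ⟨c, fun t => f (min t m), by simpa using f0, by simpa [hm] using fm, hc⟩

/-- The arrangement filling the first `w` of `w + 1` stacks, with objects ordered by `σ`. -/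
def Arrangement.ofPerm {w d : ℕ} (σ : Equiv.Perm (Fin (w * d))) :
    Arrangement (w * d) (w + 1) d where
  pos o := ((finProdFinEquiv.symm (σ o)).1.castSucc, (finProdFinEquiv.symm (σ o)).2)
  inj := by
    intro a b h
    rw [Prod.mk.injEq] at h
    exact σ.injective (finProdFinEquiv.symm.injective
      (Prod.ext (Fin.castSucc_injective _ h.1) h.2))
  contig := by
    intro o j _
    exact ⟨σ.symm (finProdFinEquiv ((finProdFinEquiv.symm (σ o)).1, j)), by
      simp only [Equiv.apply_symm_apply, Equiv.symm_apply_apply]⟩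

theorem Arrangement.ofPerm_injective {w d : ℕ} :
    Function.Injective (Arrangement.ofPerm (w := w) (d := d)) := by
  intro σ τ h
  refine Equiv.ext fun o => finProdFinEquiv.symm.injective ?_
  have ho : (Arrangement.ofPerm σ).pos o = (Arrangement.ofPerm τ).pos o := by rw [h]
  simp only [Arrangement.ofPerm, Prod.mk.injEq] at ho
  exact Prod.ext (Fin.castSucc_injective _ ho.1) ho.2

/-- If every filling of the first `w` stacks is reachable from `π` within `M` actions, then
`M` is large enough for the words of length `M` to outnumber the fillings. -/
theorem factorial_le_of_forall_reach {w d M : ℕ} (π : Arrangement (w * d) (w + 1) d)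
    (h : ∀ σ, ∃ m ≤ M, Reach π (Arrangement.ofPerm σ) m) :
    (w * d).factorial ≤ (w + 1) ^ (2 * M) := by
  have hword : ∀ σ, ∃ c : Fin M → Fin (w + 1) × Fin (w + 1),
      FollowsWord c π (Arrangement.ofPerm σ) := fun σ => by
    obtain ⟨m, hm, hr⟩ := h σ
    exact hr.exists_followsWord hm
  choose c hc using hword
  have hinj : Function.Injective c := fun σ τ hστ =>
    Arrangement.ofPerm_injective ((hc σ).right_unique (hστ ▸ hc τ))
  have hcard := Fintype.card_le_of_injective c hinj
  simpa [Fintype.card_perm, pow_mul, sq] using hcard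

/-- For all `w ≥ 2`, `d ≥ 1`, there exists an LSR instance with `n = w*d`
objects whose every solution consists of at least `log((wd)!) / (2·log(w+1))`
permissible pop-and-push actions. -/
theorem lsr_counting_lower_bound (w d : ℕ) (hw : 2 ≤ w) (hd : 1 ≤ d) :
    ∃ πI πG : Arrangement (w * d) (w + 1) d,
      ∀ m : ℕ, Reach πI πG m →
        Real.log (Nat.factorial (w * d)) / (2 * Real.log (w + 1)) ≤ (m : ℝ) := by
  by_contra! hcon
  choose m hm hlt using fun σ => hcon (Arrangement.ofPerm 1) (Arrangement.ofPerm σ)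
  obtain ⟨τ, hτ⟩ := Finite.exists_max m
  have hfac := factorial_le_of_forall_reach _ fun σ => ⟨m σ, hτ σ, hm σ⟩
  have hlog : 0 < Real.log ((w : ℝ) + 1) := by
    apply Real.log_pos
    have : (2 : ℝ) ≤ w := by exact_mod_cast hw
    linarith
  have hle : Real.log (Nat.factorial (w * d)) ≤ Real.log (((w : ℝ) + 1) ^ (2 * m τ)) :=
    Real.log_le_log (by exact_mod_cast Nat.factorial_pos _) (by exact_mod_cast hfac)
  rw [Real.log_pow] at hle
  push_cast at hle
  have h := (lt_div_iff₀ (by positivity)).1 (hlt τ)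
  linarith
end

section
/- There exists a universal constant c > 0 such that for every integer d ≥ 3, setting w = ⌈exp(√(log d))⌉, there exists an LSR instance (π_I, π_G) with n = wd objects whose every solution consists of at least c · w · d · √(log d) permissible pop-and-push actions. -/
/-- Relabel the objects of an arrangement by a permutation. -/
def Arrangement.relabel_s9 {n k d : ℕ} (π : Arrangement n k d) (σ : Equiv.Perm (Fin n)) :
    Arrangement n k d where
  pos o := π.pos (σ o)
  inj := π.inj.comp σ.injective
  contig o j h := by
    obtain ⟨o', ho'⟩ := π.contig (σ o) j h
    exact ⟨σ.symm o', by simpa using ho'⟩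

theorem Arrangement.relabel_injective {n k d : ℕ} (π : Arrangement n k d) :
    Function.Injective π.relabel_s9 := by
  intro σ τ h
  ext1 o
  exact π.inj (congrFun (congrArg Arrangement.pos h) o)

/-- The arrangement that fills the first `w` of `w + 1` stacks and leaves the last one empty. -/
def Arrangement.full (w d : ℕ) : Arrangement (w * d) (w + 1) d where
  pos o := ((finProdFinEquiv.symm o).1.castSucc, (finProdFinEquiv.symm o).2)
  inj o o' h := by
    rw [Prod.mk.injEq] at h
    exact finProdFinEquiv.symm.injective
      (Prod.ext (Fin.castSucc_injective w h.1) h.2)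
  contig o j _ := ⟨finProdFinEquiv ((finProdFinEquiv.symm o).1, j), by
    rw [Equiv.symm_apply_apply]⟩

/-- `StepVia π π' a`: a permissible action moves an object from stack `a.1` to stack `a.2`. -/
def StepVia {n k d : ℕ} (π π' : Arrangement n k d) (a : Fin k × Fin k) : Prop :=
  ∃ o : Fin n,
    (π.pos o).1 = a.1 ∧ (π'.pos o).1 = a.2 ∧ a.2 ≠ a.1 ∧
    (∀ o' : Fin n, o' ≠ o → (π.pos o').1 = (π.pos o).1 → (π.pos o).2 < (π.pos o').2) ∧
    (∀ o' : Fin n, o' ≠ o → π'.pos o' = π.pos o')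

theorem Step.exists_stepVia {n k d : ℕ} {π π' : Arrangement n k d} (h : Step π π') :
    ∃ a, StepVia π π' a := by
  obtain ⟨o, hne, htop, hrest⟩ := h
  exact ⟨((π.pos o).1, (π'.pos o).1), o, rfl, rfl, hne, htop, hrest⟩

/-- Two arrangements that agree off `o` and place `o` in the same stack place it at the same
depth (one of the two inequalities). -/
theorem Arrangement.not_depth_lt_of_eq_off {n k d : ℕ} {π π' : Arrangement n k d} {o : Fin n}
    (hoff : ∀ o', o' ≠ o → π.pos o' = π'.pos o') (hstack : (π.pos o).1 = (π'.pos o).1) :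
    ¬ (π.pos o).2 < (π'.pos o).2 := by
  intro hlt
  obtain ⟨o', ho'⟩ := π.contig o _ hlt.le
  have hne : o' ≠ o := by
    rintro rfl
    rw [ho'] at hlt
    exact lt_irrefl _ hlt
  refine hne (π'.inj ?_)
  rw [← hoff o' hne, ho', hstack]

/-- The source and target stacks determine the outcome of a permissible action. -/
theorem StepVia.unique {n k d : ℕ} {π π₁ π₂ : Arrangement n k d} {a : Fin k × Fin k}
    (h₁ : StepVia π π₁ a) (h₂ : StepVia π π₂ a) : π₁ = π₂ := by
  obtain ⟨o, hs, ht, -, htop, hrest⟩ := h₁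
  obtain ⟨o₂, hs₂, ht₂, -, htop₂, hrest₂⟩ := h₂
  obtain rfl : o₂ = o := by
    by_contra hne
    exact lt_asymm (htop o₂ hne (hs₂.trans hs.symm))
      (htop₂ o (Ne.symm hne) (hs.trans hs₂.symm))
  have hoff : ∀ o', o' ≠ o₂ → π₁.pos o' = π₂.pos o' := fun o' h =>
    (hrest o' h).trans (hrest₂ o' h).symm
  have hstack : (π₁.pos o₂).1 = (π₂.pos o₂).1 := ht.trans ht₂.symm
  refine Arrangement.ext_pos fun o' => ?_
  by_cases h : o' = o₂
  · subst h
    exact Prod.ext hstack (le_antisymm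
      (not_lt.1 (Arrangement.not_depth_lt_of_eq_off (fun o h => (hoff o h).symm) hstack.symm))
      (not_lt.1 (Arrangement.not_depth_lt_of_eq_off hoff hstack)))
  · exact hoff o' h

open Classical in
/-- Perform the action with the given source and target stacks if it is permissible,
and do nothing otherwise. -/
noncomputable def Arrangement.act {n k d : ℕ} (π : Arrangement n k d) (a : Fin k × Fin k) :
    Arrangement n k d :=
  if h : ∃ π', StepVia π π' a then h.choose else π

theorem Arrangement.act_eq_of_stepVia {n k d : ℕ} {π π' : Arrangement n k d}
    {a : Fin k × Fin k} (h : StepVia π π' a) : π.act a = π' := by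
  have hex : ∃ π', StepVia π π' a := ⟨π', h⟩
  rw [Arrangement.act, dif_pos hex]
  exact hex.choose_spec.unique h

theorem Arrangement.act_diag {n k d : ℕ} (π : Arrangement n k d) (i : Fin k) :
    π.act (i, i) = π := by
  rw [Arrangement.act, dif_neg]
  rintro ⟨π', o, -, -, hne, -⟩
  exact hne rfl

/-- Everything reachable in at most `M` actions is parametrized by words of length `M` over
pairs of stacks. -/
theorem exists_parametrization_of_reach {n k d : ℕ} (π : Arrangement n (k + 1) d) (M : ℕ) :
    ∃ F : (Fin M → Fin (k + 1) × Fin (k + 1)) → Arrangement n (k + 1) d,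
      ∀ m, m ≤ M → ∀ π', Reach π π' m → ∃ v, F v = π' := by
  induction M with
  | zero =>
    refine ⟨fun _ => π, fun m hm π' hr => ⟨Fin.elim0, ?_⟩⟩
    obtain rfl : m = 0 := Nat.le_zero.1 hm
    obtain ⟨f, h0, h1, -⟩ := hr
    exact h0.symm.trans h1
  | succ M ih =>
    obtain ⟨F, hF⟩ := ih
    refine ⟨fun v => (F (Fin.init v)).act (v (Fin.last M)), fun m hm π' hr => ?_⟩
    rcases Nat.le_succ_iff.1 hm with hm | rfl
    · obtain ⟨v, rfl⟩ := hF m hm π' hr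
      exact ⟨Fin.snoc (α := fun _ => Fin (k + 1) × Fin (k + 1)) v (0, 0), by
        simp only [Fin.init_snoc, Fin.snoc_last, Arrangement.act_diag]⟩
    · obtain ⟨f, h0, h1, hstep⟩ := hr
      obtain ⟨v, hv⟩ := hF M le_rfl (f M) ⟨f, h0, rfl, fun t ht => hstep t (by omega)⟩
      obtain ⟨a, ha⟩ := (hstep M (Nat.lt_succ_self M)).exists_stepVia
      refine ⟨Fin.snoc (α := fun _ => Fin (k + 1) × Fin (k + 1)) v a, ?_⟩
      simp only [Fin.init_snoc, Fin.snoc_last, hv]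
      exact (Arrangement.act_eq_of_stepVia ha).trans h1

/-- If there are more relabelings than words of length `M`, some relabeling of an arrangement
is not reachable in at most `M` actions. -/
theorem exists_relabel_forall_reach_lt {n k d : ℕ} (π : Arrangement n (k + 1) d) (M : ℕ)
    (h : ((k + 1) * (k + 1)) ^ M < n.factorial) :
    ∃ σ, ∀ m, Reach π (π.relabel_s9 σ) m → M < m := by
  by_contra! hcon
  obtain ⟨F, hF⟩ := exists_parametrization_of_reach π M
  have hword : ∀ σ, ∃ v, F v = π.relabel_s9 σ := fun σ => by
    obtain ⟨m, hr, hm⟩ := hcon σ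
    exact hF m hm _ hr
  choose v hv using hword
  have hinj : Function.Injective v := fun σ τ hστ =>
    π.relabel_injective (by rw [← hv σ, ← hv τ, hστ])
  have hcard := Fintype.card_le_of_injective v hinj
  simp only [Fintype.card_perm, Fintype.card_fun, Fintype.card_prod, Fintype.card_fin] at hcard
  exact absurd h (not_lt.2 hcard)

theorem mul_log_sub_le_log_factorial {n : ℕ} (hn : 0 < n) :
    (n : ℝ) * Real.log n - n ≤ Real.log n.factorial := by
  have hn' : (0 : ℝ) < n := Nat.cast_pos.2 hn
  have hf : (0 : ℝ) < n.factorial := Nat.cast_pos.2 n.factorial_pos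
  have h := Real.log_le_log (by positivity) (Real.pow_div_factorial_le_exp (n : ℝ) hn'.le n)
  rw [Real.log_exp, Real.log_div (by positivity) hf.ne', Real.log_pow] at h
  linarith

/-- There is a universal constant `c > 0` such that for every `d ≥ 3`,
setting `w = ⌈exp(√(log d))⌉`, there exists an LSR instance with `n = w*d` objects whose
every solution consists of at least `c·w·d·√(log d)` permissible pop-and-push actions. -/
theorem lsr_sqrt_log_lower_bound :
    ∃ c : ℝ, 0 < c ∧ ∀ d : ℕ, 3 ≤ d →
      ∀ w : ℕ, w = ⌈Real.exp (Real.sqrt (Real.log d))⌉₊ →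
        ∃ πI πG : Arrangement (w * d) (w + 1) d,
          ∀ m : ℕ, Reach πI πG m →
            c * w * d * Real.sqrt (Real.log d) ≤ (m : ℝ) := by
  refine ⟨1 / 8, by norm_num, fun d hd w hw => ?_⟩
  set L := Real.sqrt (Real.log d)
  have hd3 : (3 : ℝ) ≤ d := by exact_mod_cast hd
  have hlogd : 1 ≤ Real.log d := by
    rw [Real.le_log_iff_exp_le (by linarith)]
    linarith [Real.exp_one_lt_d9]
  have hL1 : 1 ≤ L := Real.one_le_sqrt.2 hlogd
  have hLsq : L * L = Real.log d := Real.mul_self_sqrt (by linarith)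
  have hexp : Real.exp L ≤ w := hw ▸ Nat.le_ceil _
  have hwlt : (w : ℝ) < Real.exp L + 1 := hw ▸ Nat.ceil_lt_add_one (Real.exp_pos L).le
  have hw0 : (0 : ℝ) < w := (Real.exp_pos L).trans_le hexp
  have hlogw : L ≤ Real.log w := (Real.le_log_iff_exp_le hw0).2 hexp
  have hlogw1 : Real.log (w + 1) ≤ 2 * L := by
    have hle : (w : ℝ) + 1 ≤ Real.exp (L + 1) := by
      rw [Real.exp_add]
      nlinarith [Real.exp_one_gt_d9, Real.exp_le_exp.2 hL1]
    have := Real.log_le_log (by positivity) hle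
    rw [Real.log_exp] at this
    linarith
  have hN : 0 < w * d := Nat.mul_pos (by exact_mod_cast hw0) (by omega)
  have hNR : (0 : ℝ) < w * d := by exact_mod_cast hN
  set M := ⌊1 / 8 * (w : ℝ) * d * L⌋₊
  have hMle : (M : ℝ) ≤ 1 / 8 * (w : ℝ) * d * L := Nat.floor_le (by positivity)
  have hfact : (w * d : ℝ) * (L * L) ≤ Real.log (w * d).factorial := by
    have h := mul_log_sub_le_log_factorial hN
    push_cast at h
    rw [Real.log_mul hw0.ne' (by positivity), ← hLsq] at h
    nlinarith
  have hcount : ((w + 1) * (w + 1)) ^ M < (w * d).factorial := by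
    have hlt : Real.log ((((w + 1) * (w + 1)) ^ M : ℕ) : ℝ) < Real.log (w * d).factorial := by
      refine lt_of_lt_of_le ?_ hfact
      push_cast
      rw [Real.log_pow, Real.log_mul (by positivity) (by positivity)]
      calc (M : ℝ) * (Real.log (w + 1) + Real.log (w + 1)) ≤ M * (4 * L) := by
            gcongr
            linarith
        _ ≤ 1 / 8 * (w : ℝ) * d * L * (4 * L) := by gcongr
        _ < (w * d : ℝ) * (L * L) := by
            have : 0 < (w * d : ℝ) * (L * L) := by positivity
            linarith
    exact_mod_cast (Real.log_lt_log_iff (by positivity)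
      (Nat.cast_pos.2 (Nat.factorial_pos _))).1 hlt
  obtain ⟨σ, hσ⟩ := exists_relabel_forall_reach_lt (Arrangement.full w d) M hcount
  exact ⟨_, _, fun m hr => (Nat.lt_of_floor_lt (hσ m hr)).le⟩
end

section
/- For every fixed integer w ≥ 2 there exists a constant c > 0 such that for every integer d ≥ 2, there exists an LSR instance (π_I, π_G) with n = wd objects whose every solution consists of at least c · d · log d permissible pop-and-push actions. -/
namespace Arrangement

variable {n k d : ℕ}

theorem pos_injective : Function.Injective (pos : Arrangement n k d → _) := by
  rintro ⟨p, _, _⟩ ⟨q, _, _⟩ h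
  cases h
  rfl

noncomputable instance : Fintype (Arrangement n k d) := Fintype.ofInjective _ pos_injective

instance : DecidableEq (Arrangement n k d) := pos_injective.decidableEq

/-- `StepVia i j π π'`: a permissible action moves the top object of stack `i` to stack `j`. -/
def StepVia (i j : Fin k) (π π' : Arrangement n k d) : Prop :=
  ∃ o : Fin n, (π.pos o).1 = i ∧ (π'.pos o).1 = j ∧ i ≠ j ∧
    (∀ o' : Fin n, o' ≠ o → (π.pos o').1 = i → (π.pos o).2 < (π.pos o').2) ∧
    (∀ o' : Fin n, o' ≠ o → π'.pos o' = π.pos o')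

theorem exists_stepVia {π π' : Arrangement n k d} (h : Step π π') :
    ∃ i j, StepVia i j π π' := by
  obtain ⟨o, h1, h2, h3⟩ := h
  exact ⟨_, _, o, rfl, rfl, h1.symm, h2, h3⟩

/-- An object that is the only one placed differently in two arrangements cannot be strictly
higher in one of them while staying in the same stack. -/
theorem le_depth_of_agree {π' π'' : Arrangement n k d} {o : Fin n}
    (hs : (π'.pos o).1 = (π''.pos o).1) (h : ∀ o', o' ≠ o → π'.pos o' = π''.pos o') :
    (π''.pos o).2 ≤ (π'.pos o).2 := by
  by_contra! hlt
  obtain ⟨o', ho'⟩ := π'.contig o (π''.pos o).2 hlt.le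
  have hne : o' ≠ o := by
    rintro rfl
    rw [ho'] at hlt
    exact lt_irrefl _ hlt
  refine hne (π''.inj ?_)
  rw [← h o' hne, ho', hs]

theorem StepVia.unique {i j : Fin k} {π π' π'' : Arrangement n k d}
    (h' : StepVia i j π π') (h'' : StepVia i j π π'') : π' = π'' := by
  obtain ⟨o, hi, hj, -, htop, hfix⟩ := h'
  obtain ⟨p, hi', hj', -, htop', hfix'⟩ := h''
  obtain rfl : o = p := by
    by_contra hne
    exact lt_asymm (htop p (Ne.symm hne) hi') (htop' o hne hi)
  have hagree : ∀ o', o' ≠ o → π'.pos o' = π''.pos o' := fun o' ho' =>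
    (hfix o' ho').trans (hfix' o' ho').symm
  have hs : (π'.pos o).1 = (π''.pos o).1 := hj.trans hj'.symm
  apply pos_injective
  funext x
  by_cases hx : x = o
  · subst hx
    exact Prod.ext hs (le_antisymm
      (le_depth_of_agree hs.symm fun o' ho' => (hagree o' ho').symm)
      (le_depth_of_agree hs hagree))
  · exact hagree x hx

open Classical in
/-- The result of an action given by its source and target stacks; `none` does nothing. -/
noncomputable def move (π : Arrangement n k d) : Option (Fin k × Fin k) → Arrangement n k d
  | none => π
  | some p => if h : ∃ π', StepVia p.1 p.2 π π' then h.choose else π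

theorem exists_move_eq {π π' : Arrangement n k d} (h : Step π π') : ∃ a, π.move a = π' := by
  obtain ⟨i, j, hij⟩ := exists_stepVia h
  have hex : ∃ π', StepVia i j π π' := ⟨π', hij⟩
  refine ⟨some (i, j), ?_⟩
  simp only [move, dif_pos hex]
  exact hex.choose_spec.unique hij

/-- The arrangements obtained from `π` by `M` moves, some of which may do nothing. -/
noncomputable def ball (π : Arrangement n k d) : ℕ → Finset (Arrangement n k d)
  | 0 => {π}
  | M + 1 => Finset.image₂ move (ball π M) Finset.univ

theorem card_ball_le (π : Arrangement n k d) (M : ℕ) : (π.ball M).card ≤ (k * k + 1) ^ M := by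
  induction M with
  | zero => simp [ball]
  | succ M ih =>
    refine (Finset.card_image₂_le _ _ _).trans ?_
    rw [pow_succ]
    refine Nat.mul_le_mul ih ?_
    simp

theorem ball_mono (π : Arrangement n k d) : Monotone π.ball :=
  monotone_nat_of_le_succ fun _ _ hx =>
    Finset.mem_image₂.mpr ⟨_, hx, none, Finset.mem_univ _, rfl⟩

theorem mem_ball_of_reach {π π' : Arrangement n k d} {m : ℕ} (h : Reach π π' m) :
    π' ∈ π.ball m := by
  obtain ⟨f, rfl, rfl, hf⟩ := h
  induction m with
  | zero => simp [ball]
  | succ m ih =>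
    obtain ⟨a, ha⟩ := exists_move_eq (hf m m.lt_succ_self)
    exact Finset.mem_image₂.mpr
      ⟨_, ih fun t ht => hf t (ht.trans m.lt_succ_self), a, Finset.mem_univ _, ha⟩

/-- The arrangement filling all stacks but the last in the order given by a permutation. -/
def ofPerm_s10 {w d : ℕ} (σ : Equiv.Perm (Fin (w * d))) : Arrangement (w * d) (w + 1) d where
  pos o := ((finProdFinEquiv.symm (σ o)).1.castSucc, (finProdFinEquiv.symm (σ o)).2)
  inj a b h := by
    obtain ⟨h1, h2⟩ := Prod.mk.inj h
    exact σ.injective (finProdFinEquiv.symm.injective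
      (Prod.ext (Fin.castSucc_injective _ h1) h2))
  contig o j _ := ⟨σ.symm (finProdFinEquiv ((finProdFinEquiv.symm (σ o)).1, j)), by
    simp only [Equiv.apply_symm_apply, Equiv.symm_apply_apply]⟩

theorem ofPerm_injective_s10 {w d : ℕ} : Function.Injective (ofPerm_s10 (w := w) (d := d)) := by
  intro σ τ h
  ext1 o
  obtain ⟨h1, h2⟩ := Prod.mk.inj (congrFun (congrArg pos h) o)
  exact finProdFinEquiv.symm.injective (Prod.ext (Fin.castSucc_injective _ h1) h2)

theorem factorial_le_card (w d : ℕ) :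
    (w * d).factorial ≤ Fintype.card (Arrangement (w * d) (w + 1) d) := by
  simpa [Fintype.card_perm] using
    Fintype.card_le_of_injective _ (ofPerm_injective_s10 (w := w) (d := d))

end Arrangement

theorem pow_self_le_factorial_mul {w : ℕ} (hw : 2 ≤ w) (d : ℕ) :
    d ^ d ≤ (w * d).factorial :=
  calc d ^ d ≤ (d + 1) ^ d := Nat.pow_le_pow_left d.le_succ d
    _ ≤ d.factorial * (d + 1) ^ d := Nat.le_mul_of_pos_left _ d.factorial_pos
    _ ≤ (d + d).factorial := Nat.factorial_mul_pow_le_factorial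
    _ ≤ (w * d).factorial := Nat.factorial_le (by nlinarith)

/-- For every fixed `w ≥ 2` there is a constant `c > 0` such that for every
`d ≥ 2`, there exists an LSR instance with `n = w*d` objects whose every solution consists
of at least `c·d·log d` permissible pop-and-push actions. -/
theorem lsr_const_w_lower_bound (w : ℕ) (hw : 2 ≤ w) :
    ∃ c : ℝ, 0 < c ∧ ∀ d : ℕ, 2 ≤ d →
      ∃ πI πG : Arrangement (w * d) (w + 1) d,
        ∀ m : ℕ, Reach πI πG m →
          c * d * Real.log d ≤ (m : ℝ) := by
  set K : ℕ := (w + 1) * (w + 1) + 1 with hK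
  have hlogK : 0 < Real.log K := Real.log_pos (by rw [hK]; exact_mod_cast (by nlinarith))
  refine ⟨1 / (2 * Real.log K), by positivity, fun d hd => ?_⟩
  have hd0 : (0 : ℝ) < d := by exact_mod_cast (by omega)
  have hlogd : 0 < Real.log d := Real.log_pos (by exact_mod_cast (by omega))
  refine ⟨Arrangement.ofPerm_s10 1, ?_⟩
  by_contra! hcon
  set X : ℝ := 1 / (2 * Real.log K) * d * Real.log d with hX
  have hX0 : 0 ≤ X := by positivity
  have hball : ∀ π, π ∈ (Arrangement.ofPerm_s10 (1 : Equiv.Perm (Fin (w * d)))).ball ⌊X⌋₊ := by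
    intro π
    obtain ⟨m, hm, hlt⟩ := hcon π
    exact Arrangement.ball_mono _ (Nat.le_floor hlt.le) (Arrangement.mem_ball_of_reach hm)
  have hcount : d ^ d ≤ K ^ ⌊X⌋₊ :=
    calc d ^ d ≤ (w * d).factorial := pow_self_le_factorial_mul hw d
      _ ≤ Fintype.card (Arrangement (w * d) (w + 1) d) := Arrangement.factorial_le_card w d
      _ ≤ _ := Finset.card_le_card fun π _ => hball π
      _ ≤ K ^ ⌊X⌋₊ := Arrangement.card_ball_le _ _
  have hlog : d * Real.log d ≤ ⌊X⌋₊ * Real.log K := by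
    rw [← Real.log_pow, ← Real.log_pow]
    exact Real.log_le_log (by positivity) (by exact_mod_cast hcount)
  have hfloor : ⌊X⌋₊ * Real.log K ≤ X * Real.log K :=
    mul_le_mul_of_nonneg_right (Nat.floor_le hX0) hlogK.le
  have hhalf : X * Real.log K = d * Real.log d / 2 := by
    rw [hX]
    field_simp
  have hpos : 0 < d * Real.log d := mul_pos hd0 hlogd
  linarith
end
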